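/- Let 0<α<n, 1<p<n/α, 1/q=1/p−α/n, 0<κ<p/q, and w∈A_{p,q}. Let K be a measurable kernel with |K(x,y)| ≤ C_K|x−y|^{α−n} for x≠y, and let b∈BMO(ℝⁿ). For a ball B define, for x∈B, G(x) = ∫_{ℝⁿ∖2B}|b(y)−b_B|·|K(x,y)|·|f(y)|dy. Then there is a constant C (independent of B and f) such that w^q(B)^{−κ/p}(∫_B G(x)^q w^q(x)dx)^{1/q} ≤ C‖b‖_*‖f‖_{L^{p,κ}(w^p,w^q)}. -/

import Mathlib

open MeasureTheory Metric Set
open scoped ENNReal NNReal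

noncomputable section

/-- Euclidean space ℝⁿ. -/
abbrev Rn (n : ℕ) := EuclideanSpace ℝ (Fin n)

variable {n : ℕ}

/-- A weight: a nonnegative locally integrable function on ℝⁿ. -/
def IsWeight (w : Rn n → ℝ) : Prop :=
  (∀ x, 0 ≤ w x) ∧ LocallyIntegrable w volume

/-- Weighted measure of a set: `v(E) = ∫_E v`. -/
def wMeas (v : Rn n → ℝ) (E : Set (Rn n)) : ℝ≥0∞ :=
  ∫⁻ x in E, ENNReal.ofReal (v x)

/-- Average of `b` over a set: `b_E = |E|⁻¹ ∫_E b`. -/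
def avg (b : Rn n → ℝ) (E : Set (Rn n)) : ℝ :=
  ⨍ y in E, b y

/-- BMO seminorm ‖b‖_*. -/
def bmoNorm (b : Rn n → ℝ) : ℝ≥0∞ :=
  ⨆ (x : Rn n) (r : ℝ) (_ : 0 < r),
    (volume (ball x r))⁻¹ *
      ∫⁻ y in ball x r, ENNReal.ofReal |b y - avg b (ball x r)|

/-- `b ∈ BMO(ℝⁿ)`. -/
def IsBMO (b : Rn n → ℝ) : Prop :=
  LocallyIntegrable b volume ∧ bmoNorm b ≠ ∞

/-- Homogeneous Lipschitz seminorm of order β. -/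
def lipNorm (β : ℝ) (b : Rn n → ℝ) : ℝ≥0∞ :=
  ⨆ (x : Rn n) (h : Rn n) (_ : h ≠ 0),
    ENNReal.ofReal (|b (x + h) - b x| / ‖h‖ ^ β)

/-- Two-weight weighted Morrey norm ‖f‖_{L^{p,κ}(u,v)}. -/
def morreyNorm (p κ : ℝ) (u v : Rn n → ℝ) (f : Rn n → ℝ) : ℝ≥0∞ :=
  ⨆ (x : Rn n) (r : ℝ) (_ : 0 < r),
    ((wMeas v (ball x r)) ^ (-κ) *
      (∫⁻ y in ball x r, ENNReal.ofReal |f y| ^ p * ENNReal.ofReal (u y))) ^ (1 / p)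

/-- Weighted weak Morrey norm ‖f‖_{WL^{p,κ}(v)}. -/
def weakMorreyNorm (p κ : ℝ) (v : Rn n → ℝ) (f : Rn n → ℝ) : ℝ≥0∞ :=
  ⨆ (x : Rn n) (r : ℝ) (_ : 0 < r) (t : ℝ) (_ : 0 < t),
    (wMeas v (ball x r)) ^ (-(κ / p)) * ENNReal.ofReal t *
      (wMeas v {y ∈ ball x r | t < |f y|}) ^ (1 / p)

/-- Weighted Lᵖ norm ‖f‖_{L^p(v)}. -/
def wLpNorm (p : ℝ) (v : Rn n → ℝ) (f : Rn n → ℝ) : ℝ≥0∞ :=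
  (∫⁻ x, ENNReal.ofReal |f x| ^ p * ENNReal.ofReal (v x)) ^ (1 / p)

/-- Muckenhoupt class A_{p,q} for 1 < p ≤ q < ∞. -/
def IsApq (p q : ℝ) (w : Rn n → ℝ) : Prop :=
  ∃ C : ℝ≥0, ∀ (x : Rn n) (r : ℝ), 0 < r →
    ((volume (ball x r))⁻¹ * (∫⁻ y in ball x r, ENNReal.ofReal (w y) ^ q)) ^ (1 / q) *
      ((volume (ball x r))⁻¹ *
        (∫⁻ y in ball x r, ENNReal.ofReal (w y) ^ (-(p / (p - 1))))) ^ (1 - 1 / p) ≤ C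

/-- Muckenhoupt class A_{1,q} for 1 < q < ∞. -/
def IsA1q (q : ℝ) (w : Rn n → ℝ) : Prop :=
  ∃ C : ℝ≥0, ∀ (x : Rn n) (r : ℝ), 0 < r →
    ((volume (ball x r))⁻¹ * (∫⁻ y in ball x r, ENNReal.ofReal (w y) ^ q)) ^ (1 / q) ≤
      C * essInf (fun y => ENNReal.ofReal (w y)) (volume.restrict (ball x r))

/-- Muckenhoupt class A_p for 1 < p < ∞. -/
def IsAp (p : ℝ) (w : Rn n → ℝ) : Prop :=
  ∃ C : ℝ≥0, ∀ (x : Rn n) (r : ℝ), 0 < r →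
    ((volume (ball x r))⁻¹ * (∫⁻ y in ball x r, ENNReal.ofReal (w y))) *
      ((volume (ball x r))⁻¹ *
        (∫⁻ y in ball x r, ENNReal.ofReal (w y) ^ (-(1 / (p - 1))))) ^ (p - 1) ≤ C

/-- Muckenhoupt class A_1. -/
def IsA1 (w : Rn n → ℝ) : Prop :=
  ∃ C : ℝ≥0, ∀ (x : Rn n) (r : ℝ), 0 < r →
    (volume (ball x r))⁻¹ * (∫⁻ y in ball x r, ENNReal.ofReal (w y)) ≤
      C * essInf (fun y => ENNReal.ofReal (w y)) (volume.restrict (ball x r))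

/-- Reverse Hölder class RH_r. -/
def IsRH (r : ℝ) (w : Rn n → ℝ) : Prop :=
  ∃ C : ℝ≥0, 0 < C ∧ ∀ (x : Rn n) (ρ : ℝ), 0 < ρ →
    ((volume (ball x ρ))⁻¹ * (∫⁻ y in ball x ρ, ENNReal.ofReal (w y) ^ r)) ^ (1 / r) ≤
      C * ((volume (ball x ρ))⁻¹ * (∫⁻ y in ball x ρ, ENNReal.ofReal (w y)))

/-- The integral operator `Tf(x) = ∫ K(x,y) f(y) dy`. -/
def intOp (K : Rn n → Rn n → ℝ) (f : Rn n → ℝ) (x : Rn n) : ℝ :=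
  ∫ y, K x y * f y

/-- The commutator `[b,T]f(x) = b(x)Tf(x) - T(bf)(x)`. -/
def commOp (b : Rn n → ℝ) (K : Rn n → Rn n → ℝ) (f : Rn n → ℝ) (x : Rn n) : ℝ :=
  b x * intOp K f x - intOp K (fun y => b y * f y) x

section PairedMeasures

variable {X : Type*} [MeasurableSpace X] {μ σ τ : Measure X} {θ η : ℝ}

lemma measure_le_of_pair {C K : ℝ≥0∞} (hθ : 0 < θ) (hη : 0 ≤ η) {F B : Set X} (hFB : F ⊆ B)
    (h1 : μ F ≤ σ F ^ θ * τ F ^ η) (h2 : σ B ^ θ * τ B ^ η ≤ C * μ B)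
    (hK : μ B ≤ K * μ F) (h0 : μ F ≠ 0) (hF : μ F ≠ ∞) :
    σ B ≤ (C * K) ^ (1 / θ) * σ F := by
  have key : μ F * σ B ^ θ ≤ μ F * (C * K * σ F ^ θ) := calc
    μ F * σ B ^ θ ≤ σ F ^ θ * τ B ^ η * σ B ^ θ := by
      gcongr
      exact h1.trans (by gcongr)
    _ = σ F ^ θ * (σ B ^ θ * τ B ^ η) := by ring
    _ ≤ σ F ^ θ * (C * (K * μ F)) :=
      mul_le_mul' le_rfl (h2.trans (mul_le_mul' le_rfl hK))
    _ = μ F * (C * K * σ F ^ θ) := by ring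
  rw [ENNReal.mul_le_mul_iff_right h0 hF] at key
  have := ENNReal.rpow_le_rpow key (by positivity : 0 ≤ 1 / θ)
  rwa [ENNReal.mul_rpow_of_nonneg _ _ (by positivity), ← ENNReal.rpow_mul, ← ENNReal.rpow_mul,
    mul_one_div_cancel hθ.ne', ENNReal.rpow_one, ENNReal.rpow_one] at this

/-- The `A_∞` property: a set occupying at most half of `Q` in the sense of `μ` misses a fixed
proportion of `Q` in the sense of `σ`. -/
lemma exists_measure_le_mul_of_pair {C K : ℝ≥0∞} (hC : C ≠ ∞) (hK : K ≠ ∞)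
    (hθ : 0 < θ) (hη : 0 ≤ η) (h1 : ∀ F, MeasurableSet F → μ F ≤ σ F ^ θ * τ F ^ η) :
    ∃ γ : ℝ≥0∞, γ < 1 ∧ ∀ E Q B : Set X, MeasurableSet E → MeasurableSet Q → E ⊆ Q → Q ⊆ B →
      σ B ^ θ * τ B ^ η ≤ C * μ B → μ Q ≠ 0 → μ Q ≠ ∞ → σ Q ≠ ∞ →
      μ B ≤ K * μ Q → 2 * μ E ≤ μ Q → σ E ≤ γ * σ Q := by
  set Γ : ℝ≥0∞ := (C * (2 * K)) ^ (1 / θ) with hΓ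
  have hΓt : Γ ≠ ∞ := ENNReal.rpow_ne_top_of_nonneg (by positivity)
    (ENNReal.mul_ne_top hC (ENNReal.mul_ne_top (by simp) hK))
  refine ⟨1 - Γ⁻¹, ENNReal.sub_lt_self (by simp) (by simp) (by simpa using hΓt), ?_⟩
  intro E Q B hE hQ hEQ hQB h2 h0 ht hσ hKB hEh
  have hadd : ∀ ν : Measure X, ν Q = ν E + ν (Q \ E) := fun ν => by
    rw [add_comm]; exact (measure_sdiff_add_inter Q hE).symm.trans (by
      rw [inter_eq_self_of_subset_right hEQ])
  have hEt : μ E ≠ ∞ := ne_top_of_le_ne_top ht (measure_mono hEQ)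
  have hhalf : μ Q ≤ 2 * μ (Q \ E) := by
    have h3 : μ E ≤ μ (Q \ E) := by
      have := hEh
      rw [hadd μ, two_mul] at this
      exact (ENNReal.add_le_add_iff_left hEt).1 this
    calc μ Q = μ E + μ (Q \ E) := hadd μ
      _ ≤ μ (Q \ E) + μ (Q \ E) := by gcongr
      _ = _ := (two_mul _).symm
  have hF0 : μ (Q \ E) ≠ 0 := fun h => h0 (by simpa [h] using hhalf)
  have hFt : μ (Q \ E) ≠ ∞ := ne_top_of_le_ne_top ht (measure_mono sdiff_subset)
  have hB : σ B ≤ Γ * σ (Q \ E) :=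
    measure_le_of_pair hθ hη (sdiff_subset.trans hQB) (h1 _ (hQ.diff hE)) h2
      (hKB.trans (by rw [mul_comm 2 K, mul_assoc]; gcongr)) hF0 hFt
  have hQF : Γ⁻¹ * σ Q ≤ σ (Q \ E) := by
    rw [mul_comm, ← div_eq_mul_inv]
    exact ENNReal.div_le_of_le_mul' ((measure_mono hQB).trans hB)
  have hEσ : σ (Q \ E) ≠ ∞ := ne_top_of_le_ne_top hσ (measure_mono sdiff_subset)
  rw [ENNReal.sub_mul (fun _ _ => hσ), one_mul]
  calc σ E = σ Q - σ (Q \ E) := by rw [hadd σ, ENNReal.add_sub_cancel_right hEσ]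
    _ ≤ _ := tsub_le_tsub_left hQF _

/-- Hölder's inequality with weights; the second factor need not be measurable. -/
lemma lintegral_mul_le_weighted {p p' : ℝ} (hpp : p'.HolderConjugate p) {h g ω : X → ℝ≥0∞}
    (hh : AEMeasurable h μ) (hω : AEMeasurable ω μ) (hht : ∀ x, h x ≠ ∞)
    (hω0 : ∀ᵐ x ∂μ, ω x ≠ 0) (hωt : ∀ x, ω x ≠ ∞) :
    ∫⁻ x, h x * g x ∂μ ≤
      (∫⁻ x, h x ^ p' * ω x ^ (-p') ∂μ) ^ (1 / p') * (∫⁻ x, g x ^ p * ω x ^ p ∂μ) ^ (1 / p) := by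
  obtain ⟨k, hk, hkle, hkeq⟩ := exists_measurable_le_lintegral_eq μ (fun x => h x * g x)
  rw [hkeq]
  have hle : ∀ x, k x / h x ≤ g x := fun x => ENNReal.div_le_of_le_mul' (hkle x)
  have hkh : ∀ x, k x = h x * (k x / h x) := fun x => by
    by_cases h0 : h x = 0
    · have := hkle x
      simp only [h0, zero_mul, nonpos_iff_eq_zero] at this
      simp [this]
    · exact (ENNReal.mul_div_cancel h0 (hht x)).symm
  calc ∫⁻ x, k x ∂μ = ∫⁻ x, ((fun x => h x * (ω x)⁻¹) * fun x => (k x / h x) * ω x) x ∂μ := by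
        refine lintegral_congr_ae ?_
        filter_upwards [hω0] with x hx
        simp only [Pi.mul_apply]
        calc k x = h x * (k x / h x) * ((ω x)⁻¹ * ω x) := by
              rw [ENNReal.inv_mul_cancel hx (hωt x), mul_one]; exact hkh x
          _ = _ := by ring
    _ ≤ (∫⁻ x, (h x * (ω x)⁻¹) ^ p' ∂μ) ^ (1 / p') *
        (∫⁻ x, ((k x / h x) * ω x) ^ p ∂μ) ^ (1 / p) :=
      ENNReal.lintegral_mul_le_Lp_mul_Lq μ hpp (hh.mul hω.inv)
        ((hk.aemeasurable.div hh).mul hω)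
    _ ≤ _ := by
      have hp := hpp.symm.pos
      have hp' := hpp.pos
      gcongr with x x
      · rw [ENNReal.mul_rpow_of_nonneg _ _ hp'.le, ENNReal.inv_rpow, ENNReal.rpow_neg]
      · rw [ENNReal.mul_rpow_of_nonneg _ _ hp.le]
        gcongr
        exact hle x

end PairedMeasures

section CellTree

variable {X T ι : Type*} [MeasurableSpace X] [Fintype ι] {μ σ : Measure X}

/-- The average of `b` over the cell of generation `N` below `t`, as a function of the point. -/
def cellAvg (μ : Measure X) (S : T → Set X) (ch : T → ι → T) (b : X → ℝ) : ℕ → T → X → ℝ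
  | 0, t => fun _ => ⨍ y in S t, b y ∂μ
  | N + 1, t => fun x => ∑ i, (S (ch t i)).indicator (cellAvg μ S ch b N (ch t i)) x

lemma measurable_cellAvg {S : T → Set X} {ch : T → ι → T} {b : X → ℝ}
    (hS : ∀ t, MeasurableSet (S t)) (N : ℕ) (t : T) : Measurable (cellAvg μ S ch b N t) := by
  induction N generalizing t with
  | zero => exact measurable_const
  | succ N ih => exact Finset.measurable_sum _ fun i _ => (ih _).indicator (hS _)

lemma cellAvg_succ_of_mem {S : T → Set X} {ch : T → ι → T} {b : X → ℝ} {t : T}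
    (hdisj : Pairwise fun i j => Disjoint (S (ch t i)) (S (ch t j))) {N : ℕ} {i : ι} {x : X}
    (hx : x ∈ S (ch t i)) :
    cellAvg μ S ch b (N + 1) t x = cellAvg μ S ch b N (ch t i) x := by
  simp only [cellAvg]
  rw [Finset.sum_eq_single i, indicator_of_mem hx]
  · intro j _ hj
    exact indicator_of_notMem (fun h => Set.disjoint_left.1 (hdisj hj) h hx) _
  · simp

lemma ofReal_abs_setAverage_sub_le {s : Set X} {b : X → ℝ} (hb : IntegrableOn b s μ)
    (h0 : μ s ≠ 0) (ht : μ s ≠ ∞) (c : ℝ) :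
    ENNReal.ofReal |(⨍ y in s, b y ∂μ) - c| * μ s ≤ ∫⁻ y in s, ENNReal.ofReal |b y - c| ∂μ := by
  have hfin : IsFiniteMeasure (μ.restrict s) := ⟨by simpa using ht.lt_top⟩
  have h1 : (⨍ y in s, b y ∂μ) - c = (μ.real s)⁻¹ * ∫ y in s, (b y - c) ∂μ := by
    have hr : μ.real s ≠ 0 := (ENNReal.toReal_pos h0 ht).ne'
    rw [integral_sub hb (integrable_const c), setAverage_eq, setIntegral_const]
    simp only [smul_eq_mul]
    field_simp
  have hr : 0 < μ.real s := ENNReal.toReal_pos h0 ht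
  have h2 : ENNReal.ofReal (μ.real s) = μ s := ENNReal.ofReal_toReal ht
  rw [← h2, ← ENNReal.ofReal_mul (abs_nonneg _), h1, abs_mul, abs_of_pos (inv_pos.2 hr),
    mul_comm, mul_inv_cancel_left₀ hr.ne']
  calc ENNReal.ofReal |∫ y in s, (b y - c) ∂μ| ≤ ENNReal.ofReal (∫ y in s, |b y - c| ∂μ) :=
        ENNReal.ofReal_le_ofReal (abs_integral_le_integral_abs)
    _ = _ := ofReal_integral_eq_lintegral_ofReal (hb.sub (integrable_const c)).abs
        (ae_of_all _ fun _ => abs_nonneg _)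

variable {S : T → Set X} {ch : T → ι → T} {b : X → ℝ}

/-- One stopping-time step: off the stopped set `E` the averages stay within `A` of `c`, and on
`E` the bound `hH` takes over. -/
lemma exists_stopped_set {A K lam : ℝ} (hA : 0 < A) (hK : 0 < K) (hlam : 0 < lam) {D : ℝ≥0∞}
    (hS : ∀ t, MeasurableSet (S t))
    (hun : ∀ t, S t = ⋃ i, S (ch t i))
    (hdisj : ∀ t, Pairwise fun i j => Disjoint (S (ch t i)) (S (ch t j)))
    (h0 : ∀ t, μ (S t) ≠ 0) (ht : ∀ t, μ (S t) ≠ ∞)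
    (hch : ∀ t i, μ (S t) ≤ ENNReal.ofReal K * μ (S (ch t i)))
    (hb : ∀ t, IntegrableOn b (S t) μ) (N : ℕ)
    (hH : ∀ k < N, ∀ t, ∫⁻ x in S t, ENNReal.ofReal
      (Real.exp (lam * |cellAvg μ S ch b k t x - ⨍ y in S t, b y ∂μ|)) ∂σ ≤ D * σ (S t))
    (t : T) (c : ℝ)
    (hc : ∫⁻ x in S t, ENNReal.ofReal |b x - c| ∂μ ≤ ENNReal.ofReal A * μ (S t)) :
    ∃ E ⊆ S t, MeasurableSet E ∧
      ENNReal.ofReal A * μ E ≤ ∫⁻ x in E, ENNReal.ofReal |b x - c| ∂μ ∧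
      ∫⁻ x in S t, ENNReal.ofReal (Real.exp (lam * |cellAvg μ S ch b N t x - c|)) ∂σ ≤
        ENNReal.ofReal (Real.exp (lam * A)) * σ (S t) +
          ENNReal.ofReal (Real.exp (lam * (K * A))) * D * σ E := by
  induction N generalizing t with
  | zero =>
    refine ⟨∅, empty_subset _, MeasurableSet.empty, by simp, ?_⟩
    have h1 := (ofReal_abs_setAverage_sub_le (hb t) (h0 t) (ht t) c).trans hc
    rw [ENNReal.mul_le_mul_iff_left (h0 t) (ht t), ENNReal.ofReal_le_ofReal_iff hA.le] at h1
    simp only [cellAvg, lintegral_const, Measure.restrict_apply_univ, measure_empty, mul_zero,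
      add_zero]
    gcongr
  | succ N ih =>
    have hstep : ∀ i, ∃ E ⊆ S (ch t i), MeasurableSet E ∧
        ENNReal.ofReal A * μ E ≤ ∫⁻ x in E, ENNReal.ofReal |b x - c| ∂μ ∧
        ∫⁻ x in S (ch t i),
          ENNReal.ofReal (Real.exp (lam * |cellAvg μ S ch b N (ch t i) x - c|)) ∂σ ≤
        ENNReal.ofReal (Real.exp (lam * A)) * σ (S (ch t i)) +
          ENNReal.ofReal (Real.exp (lam * (K * A))) * D * σ E := by
      intro i
      by_cases hi : ∫⁻ x in S (ch t i), ENNReal.ofReal |b x - c| ∂μ ≤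
          ENNReal.ofReal A * μ (S (ch t i))
      · exact ih (fun k hk => hH k (hk.trans (Nat.lt_succ_self N))) _ hi
      · refine ⟨S (ch t i), subset_rfl, hS _, (not_le.1 hi).le, ?_⟩
        set m : ℝ := ⨍ y in S (ch t i), b y ∂μ with hm
        have hsub : S (ch t i) ⊆ S t := by rw [hun t]; exact subset_iUnion (fun i => S (ch t i)) i
        have h1 : |m - c| ≤ K * A := by
          have h2 : ENNReal.ofReal |m - c| * μ (S (ch t i)) ≤
              ENNReal.ofReal (K * A) * μ (S (ch t i)) := calc
            _ ≤ ∫⁻ y in S (ch t i), ENNReal.ofReal |b y - c| ∂μ :=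
              ofReal_abs_setAverage_sub_le (hb _) (h0 _) (ht _) c
            _ ≤ ∫⁻ y in S t, ENNReal.ofReal |b y - c| ∂μ := lintegral_mono_set hsub
            _ ≤ ENNReal.ofReal A * (ENNReal.ofReal K * μ (S (ch t i))) :=
              hc.trans (mul_le_mul' le_rfl (hch t i))
            _ = _ := by rw [ENNReal.ofReal_mul hK.le]; ring
          rwa [ENNReal.mul_le_mul_iff_left (h0 _) (ht _),
            ENNReal.ofReal_le_ofReal_iff (by positivity)] at h2
        refine le_add_left ?_
        calc ∫⁻ x in S (ch t i),
              ENNReal.ofReal (Real.exp (lam * |cellAvg μ S ch b N (ch t i) x - c|)) ∂σ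
            ≤ ∫⁻ x in S (ch t i), ENNReal.ofReal (Real.exp (lam * (K * A))) * ENNReal.ofReal
                (Real.exp (lam * |cellAvg μ S ch b N (ch t i) x - m|)) ∂σ := by
              refine lintegral_mono fun x => ?_
              rw [← ENNReal.ofReal_mul (Real.exp_pos _).le, ← Real.exp_add, ← mul_add]
              gcongr
              have := abs_sub_le (cellAvg μ S ch b N (ch t i) x) m c
              linarith
          _ = ENNReal.ofReal (Real.exp (lam * (K * A))) * ∫⁻ x in S (ch t i), ENNReal.ofReal
                (Real.exp (lam * |cellAvg μ S ch b N (ch t i) x - m|)) ∂σ :=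
              lintegral_const_mul' _ _ ENNReal.ofReal_ne_top
          _ ≤ _ := by
              rw [mul_assoc]
              exact mul_le_mul' le_rfl (hH N (Nat.lt_succ_self N) _)
    choose E hES hEm hE1 hE2 using hstep
    have hEd : Pairwise (Function.onFun Disjoint E) := fun i j hij =>
      (hdisj t hij).mono (hES i) (hES j)
    refine ⟨⋃ i, E i, ?_, MeasurableSet.iUnion hEm, ?_, ?_⟩
    · rw [hun t]; exact iUnion_mono hES
    · rw [measure_iUnion hEd hEm, lintegral_iUnion hEm hEd, ← ENNReal.tsum_mul_left]
      exact ENNReal.tsum_le_tsum hE1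
    · have hSd : Pairwise (Function.onFun Disjoint fun i => S (ch t i)) := hdisj t
      conv_lhs => rw [hun t]
      rw [hun t, lintegral_iUnion (fun i => hS _) hSd, measure_iUnion hSd (fun i => hS _),
        measure_iUnion hEd hEm, ← ENNReal.tsum_mul_left, ← ENNReal.tsum_mul_left,
        ← ENNReal.tsum_add]
      refine ENNReal.tsum_le_tsum fun i => le_trans (le_of_eq ?_) (hE2 i)
      refine setLIntegral_congr_fun (hS _) fun x hx => ?_
      simp only [cellAvg_succ_of_mem (hdisj t) hx]

/-- Exponential integrability of functions of bounded mean oscillation on a tree of cells, with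
respect to a measure `σ` that is `A_∞` relative to `μ`. -/
lemma exists_lintegral_exp_cellAvg_le {K L : ℝ} (hK : 0 < K) (hL : 0 < L) {γ : ℝ≥0∞} (hγ : γ < 1)
    (hS : ∀ t, MeasurableSet (S t))
    (hun : ∀ t, S t = ⋃ i, S (ch t i))
    (hdisj : ∀ t, Pairwise fun i j => Disjoint (S (ch t i)) (S (ch t j)))
    (h0 : ∀ t, μ (S t) ≠ 0) (ht : ∀ t, μ (S t) ≠ ∞)
    (hch : ∀ t i, μ (S t) ≤ ENNReal.ofReal K * μ (S (ch t i)))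
    (hb : ∀ t, IntegrableOn b (S t) μ)
    (hosc : ∀ t, ∫⁻ x in S t, ENNReal.ofReal |b x - ⨍ y in S t, b y ∂μ| ∂μ ≤
      ENNReal.ofReal L * μ (S t))
    (hσ : ∀ t, ∀ E ⊆ S t, MeasurableSet E → 2 * μ E ≤ μ (S t) → σ E ≤ γ * σ (S t)) :
    ∃ lam : ℝ, 0 < lam ∧ ∃ D : ℝ≥0∞, D ≠ ∞ ∧ ∀ N t, ∫⁻ x in S t, ENNReal.ofReal
      (Real.exp (lam * |cellAvg μ S ch b N t x - ⨍ y in S t, b y ∂μ|)) ∂σ ≤ D * σ (S t) := by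
  set A : ℝ := 2 * L with hA
  have hA0 : 0 < A := by positivity
  obtain ⟨g, hg1, hg2⟩ : ∃ g : ℝ≥0∞, γ < g ∧ g < 1 := exists_between hγ
  obtain ⟨lam, hlam, hlg⟩ : ∃ lam : ℝ, 0 < lam ∧
      γ * ENNReal.ofReal (Real.exp (lam * (K * A))) ≤ g := by
    have hcont : Filter.Tendsto (fun l : ℝ => γ * ENNReal.ofReal (Real.exp (l * (K * A))))
        (nhdsWithin 0 (Ioi 0)) (nhds (γ * ENNReal.ofReal (Real.exp (0 * (K * A))))) := by
      refine ENNReal.Tendsto.const_mul ?_ (Or.inr hγ.ne_top)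
      refine (ENNReal.continuous_ofReal.comp (by fun_prop :
        Continuous fun l : ℝ => Real.exp (l * (K * A)))).continuousAt.tendsto.mono_left
          nhdsWithin_le_nhds
    have hev := hcont.eventually (ge_mem_nhds (by simpa using hg1))
    obtain ⟨l, hl, hl0⟩ := (hev.and self_mem_nhdsWithin).exists
    exact ⟨l, hl0, hl⟩
  set e : ℝ≥0∞ := ENNReal.ofReal (Real.exp (lam * A)) with he
  have hg0 : (1 - g) ≠ 0 := (tsub_pos_of_lt hg2).ne'
  set D : ℝ≥0∞ := e / (1 - g) with hD
  have hDt : D ≠ ∞ := ENNReal.div_ne_top ENNReal.ofReal_ne_top hg0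
  have hDe : e + g * D = D := by
    have h1 : (1 - g) * D = e :=
      ENNReal.mul_div_cancel hg0 (ne_top_of_le_ne_top ENNReal.one_ne_top tsub_le_self)
    rw [← h1, ← add_mul, tsub_add_cancel_of_le hg2.le, one_mul]
  refine ⟨lam, hlam, D, hDt, fun N => ?_⟩
  induction N using Nat.strong_induction_on with
  | _ N ih =>
  intro t
  set c : ℝ := ⨍ y in S t, b y ∂μ with hc
  obtain ⟨E, hES, hEm, hE1, hE2⟩ := exists_stopped_set hA0 hK hlam hS hun hdisj h0 ht hch hb N ih
    t c ((hosc t).trans (by gcongr; linarith))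
  have hE3 : 2 * μ E ≤ μ (S t) := by
    have h1 : ENNReal.ofReal L * (2 * μ E) ≤ ENNReal.ofReal L * μ (S t) := calc
      _ = ENNReal.ofReal A * μ E := by
        rw [hA, ENNReal.ofReal_mul (by norm_num)]; simp; ring
      _ ≤ _ := hE1.trans ((lintegral_mono_set hES).trans (hosc t))
    rwa [ENNReal.mul_le_mul_iff_right (by simpa using hL) ENNReal.ofReal_ne_top] at h1
  calc _ ≤ _ := hE2
    _ ≤ e * σ (S t) + ENNReal.ofReal (Real.exp (lam * (K * A))) * D * (γ * σ (S t)) := by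
      gcongr; exact hσ t E hES hEm hE3
    _ = (e + (γ * ENNReal.ofReal (Real.exp (lam * (K * A)))) * D) * σ (S t) := by ring
    _ ≤ (e + g * D) * σ (S t) := by gcongr
    _ = D * σ (S t) := by rw [hDe]

end CellTree

section Cubes

/-- The half-open cube with lower corner `a` and side length `l`. -/
def cube (a : Rn n) (l : ℝ) : Set (Rn n) :=
  {x | ∀ i, x i ∈ Ico (a i) (a i + l)}

lemma toLp_preimage_cube (a : Rn n) (l : ℝ) :
    WithLp.toLp 2 ⁻¹' cube a l = Set.pi univ fun i => Ico (a i) (a i + l) := by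
  ext z; simp [cube]

lemma measurableSet_cube (a : Rn n) (l : ℝ) : MeasurableSet (cube a l) := by
  have : cube a l = ⋂ i, (fun x : Rn n => x i) ⁻¹' Ico (a i) (a i + l) := by
    ext x; simp [cube]
  rw [this]
  exact MeasurableSet.iInter fun i => measurableSet_Ico.preimage (by fun_prop)

lemma measurableEmbedding_toLp : MeasurableEmbedding (WithLp.toLp 2 : (Fin n → ℝ) → Rn n) :=
  (MeasurableEquiv.toLp 2 (Fin n → ℝ)).measurableEmbedding

lemma volume_cube (a : Rn n) (l : ℝ) : volume (cube a l) = ENNReal.ofReal l ^ n := by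
  rw [← (PiLp.volume_preserving_toLp (Fin n)).measure_preimage_emb measurableEmbedding_toLp,
    toLp_preimage_cube, Real.volume_pi_Ico]
  simp

lemma cube_subset_ball (a : Rn n) {l : ℝ} (hl : 0 < l) : cube a l ⊆ ball a ((n + 1) * l) := by
  intro x hx
  rw [mem_ball, EuclideanSpace.dist_eq]
  have h1 : ∑ i, dist (x i) (a i) ^ 2 ≤ n * l ^ 2 := by
    calc ∑ i, dist (x i) (a i) ^ 2 ≤ ∑ _i : Fin n, l ^ 2 := by
          refine Finset.sum_le_sum fun i _ => ?_
          have := hx i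
          rw [Real.dist_eq, sq_abs]
          nlinarith [this.1, this.2]
      _ = _ := by simp
  rw [Real.sqrt_lt' (by positivity)]
  refine h1.trans_lt ?_
  have : (0 : ℝ) ≤ n := by positivity
  nlinarith [pow_pos hl 2, mul_nonneg this (pow_pos hl 2).le,
    mul_nonneg (mul_nonneg this this) (pow_pos hl 2).le]

lemma ball_subset_cube (x : Rn n) (r : ℝ) :
    ball x r ⊆ cube (x - WithLp.toLp 2 fun _ => r) (2 * r) := by
  intro y hy i
  have h1 : |y i - x i| < r := by
    have := PiLp.norm_apply_le (y - x) i
    rw [mem_ball, dist_eq_norm] at hy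
    exact (by simpa using this : |y i - x i| ≤ ‖y - x‖).trans_lt hy
  have := abs_lt.1 h1
  simp only [PiLp.sub_apply, mem_Ico]
  constructor <;> linarith

/-- The lower corner of the dyadic child of `cube a l` in position `ε`. -/
def childCorner (a : Rn n) (l : ℝ) (ε : Fin n → Bool) : Rn n :=
  a + WithLp.toLp 2 fun i => if ε i then l / 2 else 0

lemma cube_eq_iUnion (a : Rn n) {l : ℝ} (hl : 0 < l) :
    cube a l = ⋃ ε, cube (childCorner a l ε) (l / 2) := by
  ext x
  simp only [mem_iUnion]
  constructor
  · intro hx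
    refine ⟨fun i => decide (a i + l / 2 ≤ x i), fun i => ?_⟩
    have := hx i
    simp only [mem_Ico] at this
    simp only [childCorner, PiLp.add_apply, decide_eq_true_eq, mem_Ico]
    split_ifs with h <;> constructor <;> linarith
  · rintro ⟨ε, hx⟩ i
    have := hx i
    simp only [childCorner, PiLp.add_apply, mem_Ico] at this
    rw [mem_Ico]
    split_ifs at this <;> constructor <;> linarith [this.1, this.2]

lemma disjoint_cube_child (a : Rn n) (l : ℝ) :
    Pairwise fun ε ε' => Disjoint (cube (childCorner a l ε) (l / 2))
      (cube (childCorner a l ε') (l / 2)) := by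
  intro ε ε' hne
  rw [Set.disjoint_left]
  intro x hx hx'
  apply hne
  funext i
  have h1 := hx i
  have h2 := hx' i
  simp only [childCorner, PiLp.add_apply, mem_Ico] at h1 h2
  cases h : ε i <;> cases h' : ε' i <;> simp [h, h'] at h1 h2 ⊢ <;> linarith [h1.1, h1.2, h2.1, h2.2]

/-- Lebesgue differentiation along cubes containing the point. -/
lemma ae_tendsto_setAverage_cube {b : Rn n → ℝ} (hb : LocallyIntegrable b volume) :
    ∀ᵐ x : Rn n, ∀ (a : ℕ → Rn n) (l : ℕ → ℝ), (∀ k, 0 < l k) →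
      Filter.Tendsto l Filter.atTop (nhds 0) → (∀ k, x ∈ cube (a k) (l k)) →
      Filter.Tendsto (fun k => ⨍ y in cube (a k) (l k), b y) Filter.atTop (nhds (b x)) := by
  have hmp := PiLp.volume_preserving_toLp (Fin n)
  have hb' : LocallyIntegrable (b ∘ WithLp.toLp 2) (volume : Measure (Fin n → ℝ)) := by
    rw [locallyIntegrable_iff] at hb ⊢
    intro k hk
    have h1 := hb _ (hk.image (PiLp.continuous_toLp 2 _))
    rw [← hmp.integrableOn_comp_preimage measurableEmbedding_toLp] at h1
    exact h1.mono_set (subset_preimage_image _ _)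
  have h := IsUnifLocDoublingMeasure.ae_tendsto_average volume hb' 1
  have h2 := (PiLp.volume_preserving_ofLp (Fin n)).quasiMeasurePreserving.ae h
  filter_upwards [h2] with x hx a l hl hl0 hxa
  have h3 := hx (l := Filter.atTop) (fun k i => a k i + l k / 2) (fun k => l k / 2) ?_ ?_
  · refine (h3.congr fun k => ?_)
    have hae : (Set.pi univ fun i => Ico (a k i) (a k i + l k)) =ᵐ[volume]
        closedBall (fun i => a k i + l k / 2) (l k / 2) := by
      refine Measure.univ_pi_Ico_ae_eq_Icc.trans (Filter.EventuallyEq.of_eq ?_)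
      rw [← Set.pi_univ_Icc, closedBall_pi _ (by linarith [hl k])]
      refine Set.pi_congr rfl fun i _ => ?_
      rw [Real.closedBall_eq_Icc]
      congr 1 <;> ring
    rw [← setAverage_congr hae, setAverage_eq, setAverage_eq, ← toLp_preimage_cube,
      ← hmp.setIntegral_preimage_emb measurableEmbedding_toLp, measureReal_def, measureReal_def,
      hmp.measure_preimage_emb measurableEmbedding_toLp]
    rfl
  · rw [tendsto_nhdsWithin_iff]
    exact ⟨by simpa using hl0.div_const 2, Filter.Eventually.of_forall fun k => half_pos (hl k)⟩
  · refine Filter.Eventually.of_forall fun k => ?_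
    rw [one_mul, closedBall_pi _ (by linarith [hl k])]
    intro i _
    have := hxa k i
    change x i ∈ closedBall (a k i + l k / 2) (l k / 2)
    rw [Real.closedBall_eq_Icc]
    constructor <;> linarith [this.1, this.2]

/-- The tree of dyadic descendants, indexed by a corner and a positive side length. -/
def cubeChild (t : Rn n × Ioi (0 : ℝ)) (ε : Fin n → Bool) : Rn n × Ioi (0 : ℝ) :=
  (childCorner t.1 t.2 ε, ⟨(t.2 : ℝ) / 2, half_pos (mem_Ioi.1 t.2.2)⟩)

lemma exists_cellAvg_eq (b : Rn n → ℝ) (N : ℕ) (t : Rn n × Ioi (0 : ℝ)) {x : Rn n}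
    (hx : x ∈ cube t.1 t.2) :
    ∃ a, x ∈ cube a ((t.2 : ℝ) / 2 ^ N) ∧
      cellAvg volume (fun t : Rn n × Ioi (0 : ℝ) => cube t.1 t.2) cubeChild b N t x =
        ⨍ y in cube a ((t.2 : ℝ) / 2 ^ N), b y := by
  induction N generalizing t with
  | zero => exact ⟨t.1, by simpa using hx, by simp [cellAvg]⟩
  | succ N ih =>
    have hx' := hx
    rw [cube_eq_iUnion t.1 t.2.2] at hx'
    obtain ⟨ε, hε⟩ := mem_iUnion.1 hx'
    obtain ⟨a, ha, hav⟩ := ih (cubeChild t ε) hε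
    have h2 : ((cubeChild t ε).2 : ℝ) / 2 ^ N = (t.2 : ℝ) / 2 ^ (N + 1) := by
      simp only [cubeChild]; rw [pow_succ]; field_simp
    rw [h2] at ha hav
    refine ⟨a, ha, ?_⟩
    rw [← hav]
    exact cellAvg_succ_of_mem (S := fun t : Rn n × Ioi (0 : ℝ) => cube t.1 t.2)
      (disjoint_cube_child t.1 t.2) hε

/-- A function of bounded mean oscillation on cubes is exponentially integrable with respect to
every measure that is `A_∞` on cubes. -/
lemma exists_lintegral_exp_cube_le {b : Rn n → ℝ} (hb : LocallyIntegrable b volume)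
    {σ : Measure (Rn n)} (hσv : σ ≪ volume) {L : ℝ} (hL : 0 < L) {γ : ℝ≥0∞} (hγ : γ < 1)
    (hosc : ∀ a l, 0 < l → ∫⁻ x in cube a l, ENNReal.ofReal |b x - avg b (cube a l)| ≤
      ENNReal.ofReal L * volume (cube a l))
    (hσ : ∀ a l, 0 < l → ∀ E ⊆ cube a l, MeasurableSet E →
      2 * volume E ≤ volume (cube a l) → σ E ≤ γ * σ (cube a l)) :
    ∃ lam : ℝ, 0 < lam ∧ ∃ D : ℝ≥0∞, D ≠ ∞ ∧ ∀ a l, 0 < l → ∫⁻ x in cube a l, ENNReal.ofReal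
      (Real.exp (lam * |b x - avg b (cube a l)|)) ∂σ ≤ D * σ (cube a l) := by
  have hbi : ∀ (a : Rn n) (l : ℝ), 0 < l → IntegrableOn b (cube a l) volume := fun a l hl =>
    (hb.integrableOn_isCompact (isCompact_closedBall a ((n + 1) * l))).mono_set
      ((cube_subset_ball a hl).trans ball_subset_closedBall)
  obtain ⟨lam, hlam, D, hD, h⟩ := exists_lintegral_exp_cellAvg_le
    (S := fun t : Rn n × Ioi (0 : ℝ) => cube t.1 t.2) (ch := cubeChild) (μ := volume) (σ := σ)
    (b := b) (K := 2 ^ n) (by positivity) hL hγ (fun t => measurableSet_cube _ _)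
    (fun t => cube_eq_iUnion t.1 t.2.2) (fun t => disjoint_cube_child t.1 t.2)
    (fun t => by rw [volume_cube]; exact pow_ne_zero _ (ENNReal.ofReal_pos.2 t.2.2).ne')
    (fun t => by rw [volume_cube]; exact ENNReal.pow_ne_top ENNReal.ofReal_ne_top)
    (fun t ε => by
      rw [volume_cube, volume_cube, ENNReal.ofReal_pow (by norm_num), ← mul_pow,
        ← ENNReal.ofReal_mul (by norm_num)]
      simp only [cubeChild]
      rw [mul_div_cancel₀ _ (by norm_num)])
    (fun t => hbi _ _ t.2.2) (fun t => hosc _ _ t.2.2) (fun t => hσ _ _ t.2.2)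
  refine ⟨lam, hlam, D, hD, fun a l hl => ?_⟩
  set t : Rn n × Ioi (0 : ℝ) := (a, ⟨l, hl⟩) with ht
  set F : ℕ → Rn n → ℝ :=
    fun N => cellAvg volume (fun t : Rn n × Ioi (0 : ℝ) => cube t.1 t.2) cubeChild b N t with hF
  have hFm : ∀ N, Measurable (F N) := fun N =>
    measurable_cellAvg (fun t => measurableSet_cube _ _) N t
  have hlim : ∀ᵐ x ∂(σ.restrict (cube a l)),
      Filter.Tendsto (fun N => F N x) Filter.atTop (nhds (b x)) := by
    filter_upwards [ae_restrict_of_ae (hσv.ae_le (ae_tendsto_setAverage_cube hb)),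
      ae_restrict_mem (measurableSet_cube a l)] with x hx hxa
    choose c hc hcF using fun N => exists_cellAvg_eq b N t (x := x) hxa
    have h0 : Filter.Tendsto (fun N : ℕ => l / 2 ^ N) Filter.atTop (nhds 0) := by
      have := (tendsto_pow_atTop_nhds_zero_of_lt_one (r := (1 / 2 : ℝ)) (by norm_num)
        (by norm_num)).const_mul l
      simpa [div_eq_mul_inv] using this
    exact (hx c (fun N => l / 2 ^ N) (fun N => by positivity) h0 hc).congr fun N => (hcF N).symm
  calc ∫⁻ x in cube a l, ENNReal.ofReal (Real.exp (lam * |b x - avg b (cube a l)|)) ∂σ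
      = ∫⁻ x in cube a l, Filter.liminf (fun N => ENNReal.ofReal
          (Real.exp (lam * |F N x - avg b (cube a l)|))) Filter.atTop ∂σ := by
        refine lintegral_congr_ae ?_
        filter_upwards [hlim] with x hx
        refine (Filter.Tendsto.liminf_eq ?_).symm
        refine (ENNReal.continuous_ofReal.tendsto _).comp ((Real.continuous_exp.tendsto _).comp ?_)
        exact ((hx.sub_const _).abs).const_mul lam
    _ ≤ Filter.liminf (fun N => ∫⁻ x in cube a l, ENNReal.ofReal
          (Real.exp (lam * |F N x - avg b (cube a l)|)) ∂σ) Filter.atTop := by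
        refine lintegral_liminf_le fun N => ?_
        have := hFm N
        fun_prop
    _ ≤ D * σ (cube a l) :=
        Filter.liminf_le_of_le (by isBoundedDefault) fun c hc => by
          obtain ⟨N, hN⟩ := hc.exists
          exact hN.trans (h N t)

end Cubes

section Oscillation

lemma volume_ball_eq (x : Rn n) {r : ℝ} (hr : 0 < r) :
    volume (ball x r) = ENNReal.ofReal r ^ n * volume (ball (0 : Rn n) 1) := by
  rw [Measure.addHaar_ball_of_pos volume x hr, finrank_euclideanSpace_fin,
    ENNReal.ofReal_pow hr.le]

lemma volume_ball_ne_zero (x : Rn n) {r : ℝ} (hr : 0 < r) : volume (ball x r) ≠ 0 :=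
  (measure_ball_pos volume x hr).ne'

lemma volume_ball_mul (x y : Rn n) {r k : ℝ} (hr : 0 < r) (hk : 0 < k) :
    volume (ball y (k * r)) = ENNReal.ofReal k ^ n * volume (ball x r) := by
  rw [volume_ball_eq x hr, volume_ball_eq y (mul_pos hk hr), ENNReal.ofReal_mul hk.le, mul_pow,
    mul_assoc]

lemma lintegral_sub_avg_ball_le (b : Rn n → ℝ) (x : Rn n) {r : ℝ} (hr : 0 < r) :
    ∫⁻ y in ball x r, ENNReal.ofReal |b y - avg b (ball x r)| ≤
      bmoNorm b * volume (ball x r) := by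
  have h : (volume (ball x r))⁻¹ * ∫⁻ y in ball x r, ENNReal.ofReal |b y - avg b (ball x r)| ≤
      bmoNorm b :=
    le_iSup_of_le x (le_iSup_of_le r (le_iSup_of_le hr le_rfl))
  rw [mul_comm, ← div_eq_mul_inv,
    ENNReal.div_le_iff (volume_ball_ne_zero x hr) measure_ball_lt_top.ne] at h
  exact h

lemma integrableOn_ball {b : Rn n → ℝ} (hb : LocallyIntegrable b volume) (x : Rn n) (r : ℝ) :
    IntegrableOn b (ball x r) volume :=
  (hb.integrableOn_isCompact (isCompact_closedBall x r)).mono_set ball_subset_closedBall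

variable {b : Rn n → ℝ} {E B : Set (Rn n)}

lemma ofReal_abs_avg_sub_le (hb : IntegrableOn b B volume) (hEB : E ⊆ B)
    (h0 : volume E ≠ 0) (ht : volume E ≠ ∞) {c : ℝ} {M k : ℝ≥0∞}
    (hc : ∫⁻ x in B, ENNReal.ofReal |b x - c| ≤ M * volume B) (hk : volume B ≤ k * volume E) :
    ENNReal.ofReal |avg b E - c| ≤ M * k := by
  have h1 : ENNReal.ofReal |avg b E - c| * volume E ≤ M * k * volume E := calc
    _ ≤ ∫⁻ x in E, ENNReal.ofReal |b x - c| :=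
      ofReal_abs_setAverage_sub_le (hb.mono_set hEB) h0 ht c
    _ ≤ ∫⁻ x in B, ENNReal.ofReal |b x - c| := lintegral_mono_set hEB
    _ ≤ M * (k * volume E) := hc.trans (mul_le_mul' le_rfl hk)
    _ = _ := (mul_assoc _ _ _).symm
  rwa [ENNReal.mul_le_mul_iff_left h0 ht] at h1

lemma lintegral_sub_avg_le_of_subset (hb : IntegrableOn b B volume) (hEB : E ⊆ B)
    (h0 : volume E ≠ 0) (ht : volume E ≠ ∞) {c : ℝ} {M k : ℝ≥0∞}
    (hc : ∫⁻ x in B, ENNReal.ofReal |b x - c| ≤ M * volume B) (hk : volume B ≤ k * volume E) :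
    ∫⁻ x in E, ENNReal.ofReal |b x - avg b E| ≤ 2 * (M * k) * volume E := by
  calc ∫⁻ x in E, ENNReal.ofReal |b x - avg b E|
      ≤ ∫⁻ x in E, (ENNReal.ofReal |b x - c| + ENNReal.ofReal |avg b E - c|) := by
        refine lintegral_mono fun x => ?_
        rw [← ENNReal.ofReal_add (abs_nonneg _) (abs_nonneg _)]
        refine ENNReal.ofReal_le_ofReal ?_
        have := abs_sub_le (b x) c (avg b E)
        rwa [abs_sub_comm c] at this
    _ = (∫⁻ x in E, ENNReal.ofReal |b x - c|) + ENNReal.ofReal |avg b E - c| * volume E := by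
        rw [lintegral_add_right _ measurable_const, setLIntegral_const]
    _ ≤ M * (k * volume E) + M * k * volume E := by
        gcongr
        · exact (lintegral_mono_set hEB).trans (hc.trans (mul_le_mul' le_rfl hk))
        · exact ofReal_abs_avg_sub_le hb hEB h0 ht hc hk
    _ = _ := by ring

lemma ofReal_abs_avg_ball_sub_le (hb : LocallyIntegrable b volume) (x : Rn n) {r : ℝ}
    (hr : 0 < r) (k : ℕ) :
    ENNReal.ofReal |avg b (ball x (2 ^ k * r)) - avg b (ball x r)| ≤ k * (2 ^ n * bmoNorm b) := by
  induction k with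
  | zero => simp
  | succ k ih =>
    have hr' : 0 < 2 ^ k * r := by positivity
    have hE : (2 : ℝ) ^ (k + 1) * r = 2 * (2 ^ k * r) := by ring
    have hstep : ENNReal.ofReal |avg b (ball x (2 ^ k * r)) - avg b (ball x (2 ^ (k + 1) * r))| ≤
        bmoNorm b * 2 ^ n := by
      refine ofReal_abs_avg_sub_le (B := ball x (2 ^ (k + 1) * r)) (integrableOn_ball hb _ _)
        (ball_subset_ball (by rw [hE]; linarith)) (volume_ball_ne_zero x hr')
        measure_ball_lt_top.ne (lintegral_sub_avg_ball_le b x (by positivity)) ?_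
      rw [hE, volume_ball_mul x x hr' two_pos]
      simp
    calc _ ≤ ENNReal.ofReal (|avg b (ball x (2 ^ k * r)) - avg b (ball x (2 ^ (k + 1) * r))| +
          |avg b (ball x (2 ^ k * r)) - avg b (ball x r)|) := by
          refine ENNReal.ofReal_le_ofReal ?_
          rw [abs_sub_comm (avg b (ball x (2 ^ k * r))) (avg b (ball x (2 ^ (k + 1) * r)))]
          exact abs_sub_le _ _ _
      _ ≤ bmoNorm b * 2 ^ n + k * (2 ^ n * bmoNorm b) := by
          rw [ENNReal.ofReal_add (abs_nonneg _) (abs_nonneg _)]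
          gcongr
      _ = _ := by push_cast; ring

/-- Quantitative absolute continuity with respect to Lebesgue measure, on balls. -/
structure IsAInfty (σ : Measure (Rn n)) : Prop where
  ac : σ ≪ volume
  ball_ne_top : ∀ (x : Rn n) (r : ℝ), σ (ball x r) ≠ ∞
  decay : ∀ K : ℝ≥0∞, K ≠ ∞ → ∃ γ : ℝ≥0∞, γ < 1 ∧ ∀ (E Q : Set (Rn n)) (x : Rn n) (r : ℝ), 0 < r →
    MeasurableSet E → MeasurableSet Q → E ⊆ Q → Q ⊆ ball x r → volume Q ≠ 0 →
    volume (ball x r) ≤ K * volume Q → 2 * volume E ≤ volume Q → σ E ≤ γ * σ Q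
  doubling : ∀ K : ℝ≥0∞, K ≠ ∞ → ∃ Γ : ℝ≥0∞, Γ ≠ ∞ ∧ ∀ (F : Set (Rn n)) (x : Rn n) (r : ℝ), 0 < r →
    MeasurableSet F → F ⊆ ball x r → volume F ≠ 0 → volume (ball x r) ≤ K * volume F →
    σ (ball x r) ≤ Γ * σ F

lemma rpow_le_mul_exp {s lam : ℝ} (hs : 0 < s) (hlam : 0 < lam) {y : ℝ} (hy : 0 ≤ y) :
    y ^ s ≤ (s / lam) ^ s * Real.exp (lam * y) := by
  have h1 : lam * y / s ≤ Real.exp (lam * y / s) :=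
    (by linarith : lam * y / s ≤ lam * y / s + 1).trans (Real.add_one_le_exp _)
  have h2 := Real.rpow_le_rpow (by positivity) h1 hs.le
  rw [← Real.exp_mul, div_mul_cancel₀ _ hs.ne'] at h2
  calc y ^ s = (s / lam * (lam * y / s)) ^ s := by congr 1; field_simp
    _ = (s / lam) ^ s * (lam * y / s) ^ s := Real.mul_rpow (by positivity) (by positivity)
    _ ≤ _ := by gcongr

/-- A function in `BMO` has `L^s` oscillation bounded uniformly over balls, with respect to any
`A_∞` measure. -/
lemma exists_lintegral_rpow_sub_avg_le (hb : IsBMO b) {σ : Measure (Rn n)} (hσ : IsAInfty σ)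
    {s : ℝ} (hs : 0 < s) :
    ∃ D : ℝ≥0∞, D ≠ ∞ ∧ ∀ (x : Rn n) (r : ℝ), 0 < r →
      ∫⁻ y in ball x r, ENNReal.ofReal |b y - avg b (ball x r)| ^ s ∂σ ≤ D * σ (ball x r) := by
  set k : ℝ≥0∞ := ENNReal.ofReal (n + 1) ^ n * volume (ball (0 : Rn n) 1) with hk
  have hkt : k ≠ ∞ :=
    ENNReal.mul_ne_top (ENNReal.pow_ne_top ENNReal.ofReal_ne_top) measure_ball_lt_top.ne
  have hcube : ∀ (a : Rn n) (l : ℝ), 0 < l →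
      volume (ball a ((n + 1) * l)) ≤ k * volume (cube a l) := fun a l hl => by
    rw [volume_ball_eq a (by positivity), volume_cube, ENNReal.ofReal_mul (by positivity), mul_pow,
      hk]
    exact le_of_eq (by ring)
  have hc0 : ∀ (a : Rn n) (l : ℝ), 0 < l → volume (cube a l) ≠ 0 := fun a l hl => by
    rw [volume_cube]; exact pow_ne_zero _ (ENNReal.ofReal_pos.2 hl).ne'
  have hct : ∀ (a : Rn n) (l : ℝ), volume (cube a l) ≠ ∞ := fun a l => by
    rw [volume_cube]; exact ENNReal.pow_ne_top ENNReal.ofReal_ne_top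
  set M : ℝ≥0∞ := 2 * (bmoNorm b * k) + 1 with hM
  have hMt : M ≠ ∞ := ENNReal.add_ne_top.2
    ⟨ENNReal.mul_ne_top (by simp) (ENNReal.mul_ne_top hb.2 hkt), by simp⟩
  have hM0 : 0 < M.toReal := ENNReal.toReal_pos (by simp [hM]) hMt
  obtain ⟨γ, hγ, hdecay⟩ := hσ.decay k hkt
  have hosc : ∀ (a : Rn n) (l : ℝ), 0 < l →
      ∫⁻ x in cube a l, ENNReal.ofReal |b x - avg b (cube a l)| ≤
        ENNReal.ofReal M.toReal * volume (cube a l) := fun a l hl => by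
    rw [ENNReal.ofReal_toReal hMt]
    refine (lintegral_sub_avg_le_of_subset (integrableOn_ball hb.1 _ _) (cube_subset_ball a hl)
      (hc0 a l hl) (hct a l) (lintegral_sub_avg_ball_le b a (by positivity))
      (hcube a l hl)).trans ?_
    gcongr
    exact le_self_add
  obtain ⟨lam, hlam, D, hD, hexp⟩ := exists_lintegral_exp_cube_le hb.1 hσ.ac hM0 hγ hosc
    fun a l hl E hE hEm hE2 => hdecay E _ a _ (by positivity) hEm (measurableSet_cube a l) hE
      (cube_subset_ball a hl) (hc0 a l hl) (hcube a l hl) hE2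
  set k' : ℝ≥0∞ := ENNReal.ofReal ((n + 1) * 2) ^ n with hk'
  have hkt' : k' ≠ ∞ := ENNReal.pow_ne_top ENNReal.ofReal_ne_top
  obtain ⟨Γ, hΓ, hdoub⟩ := hσ.doubling k' hkt'
  set c₁ : ℝ≥0∞ := ENNReal.ofReal ((s / lam) ^ s * Real.exp (lam * (M * k').toReal)) with hc₁
  refine ⟨c₁ * (D * Γ), ENNReal.mul_ne_top ENNReal.ofReal_ne_top (ENNReal.mul_ne_top hD hΓ),
    fun x r hr => ?_⟩
  set a : Rn n := x - WithLp.toLp 2 fun _ => r with ha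
  have hl : 0 < 2 * r := by positivity
  have hBQ : ball x r ⊆ cube a (2 * r) := ball_subset_cube x r
  have hBv : volume (ball a ((n + 1) * (2 * r))) ≤ k' * volume (ball x r) := by
    rw [← mul_assoc, volume_ball_mul x a hr (by positivity)]
  have hQσ : σ (cube a (2 * r)) ≤ Γ * σ (ball x r) :=
    (measure_mono (cube_subset_ball a hl)).trans
      (hdoub _ a _ (by positivity) measurableSet_ball (hBQ.trans (cube_subset_ball a hl))
        (volume_ball_ne_zero x hr) hBv)
  have hdiff : |avg b (ball x r) - avg b (cube a (2 * r))| ≤ (M * k').toReal := by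
    have := ofReal_abs_avg_sub_le ((integrableOn_ball hb.1 _ _).mono_set (cube_subset_ball a hl))
      hBQ (volume_ball_ne_zero x hr) measure_ball_lt_top.ne (hosc a _ hl)
      ((measure_mono (cube_subset_ball a hl)).trans hBv)
    rw [ENNReal.ofReal_toReal hMt] at this
    exact (ENNReal.ofReal_le_iff_le_toReal (ENNReal.mul_ne_top hMt hkt')).1 this
  calc ∫⁻ y in ball x r, ENNReal.ofReal |b y - avg b (ball x r)| ^ s ∂σ
      ≤ ∫⁻ y in ball x r, c₁ *
          ENNReal.ofReal (Real.exp (lam * |b y - avg b (cube a (2 * r))|)) ∂σ := by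
        refine lintegral_mono fun y => ?_
        rw [ENNReal.ofReal_rpow_of_nonneg (abs_nonneg _) hs.le, hc₁,
          ← ENNReal.ofReal_mul (by positivity)]
        refine ENNReal.ofReal_le_ofReal ((rpow_le_mul_exp hs hlam (abs_nonneg _)).trans ?_)
        rw [mul_assoc, ← Real.exp_add, ← mul_add]
        gcongr
        have := abs_sub_le (b y) (avg b (cube a (2 * r))) (avg b (ball x r))
        rw [abs_sub_comm (avg b (cube a (2 * r)))] at this
        linarith
    _ ≤ ∫⁻ y in cube a (2 * r), c₁ *
          ENNReal.ofReal (Real.exp (lam * |b y - avg b (cube a (2 * r))|)) ∂σ :=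
        lintegral_mono_set hBQ
    _ = c₁ * ∫⁻ y in cube a (2 * r),
          ENNReal.ofReal (Real.exp (lam * |b y - avg b (cube a (2 * r))|)) ∂σ :=
        lintegral_const_mul' _ _ ENNReal.ofReal_ne_top
    _ ≤ c₁ * (D * (Γ * σ (ball x r))) :=
        mul_le_mul' le_rfl ((hexp a _ hl).trans (mul_le_mul' le_rfl hQσ))
    _ = _ := by ring

end Oscillation

section Weights

lemma IsAInfty.of_pair {σ τ : Measure (Rn n)} {θ η : ℝ} {C : ℝ≥0∞} (hC : C ≠ ∞) (hθ : 0 < θ)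
    (hη : 0 ≤ η) (h1 : ∀ F, MeasurableSet F → volume F ≤ σ F ^ θ * τ F ^ η)
    (h2 : ∀ (x : Rn n) (r : ℝ), 0 < r →
      σ (ball x r) ^ θ * τ (ball x r) ^ η ≤ C * volume (ball x r))
    (hac : σ ≪ volume) (hfin : ∀ (x : Rn n) (r : ℝ), σ (ball x r) ≠ ∞) : IsAInfty σ where
  ac := hac
  ball_ne_top := hfin
  decay K hK := by
    obtain ⟨γ, hγ, h⟩ := exists_measure_le_mul_of_pair hC hK hθ hη h1
    exact ⟨γ, hγ, fun E Q x r hr hE hQ hEQ hQB h0 hle hhalf => h E Q _ hE hQ hEQ hQB (h2 x r hr) h0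
      (ne_top_of_le_ne_top measure_ball_lt_top.ne (measure_mono hQB))
      (ne_top_of_le_ne_top (hfin x r) (measure_mono hQB)) hle hhalf⟩
  doubling K hK :=
    ⟨(C * K) ^ (1 / θ),
      ENNReal.rpow_ne_top_of_nonneg (by positivity) (ENNReal.mul_ne_top hC hK),
      fun F x r hr hF hFB h0 hle => measure_le_of_pair hθ hη hFB (h1 F hF) (h2 x r hr) hle h0
        (ne_top_of_le_ne_top measure_ball_lt_top.ne (measure_mono hFB))⟩

lemma IsAInfty.exists_ball_le_pow_mul {σ : Measure (Rn n)} (hσ : IsAInfty σ) (hn : n ≠ 0) :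
    ∃ γ : ℝ≥0∞, γ < 1 ∧ ∀ (x : Rn n) (r : ℝ), 0 < r → ∀ k : ℕ,
      σ (ball x r) ≤ γ ^ k * σ (ball x (2 ^ k * r)) := by
  obtain ⟨γ, hγ, h⟩ := hσ.decay 1 (by simp)
  refine ⟨γ, hγ, fun x r hr k => ?_⟩
  induction k with
  | zero => simp
  | succ k ih =>
    have hr' : 0 < 2 ^ k * r := by positivity
    have hE : (2 : ℝ) ^ (k + 1) * r = 2 * (2 ^ k * r) := by ring
    have hstep : σ (ball x (2 ^ k * r)) ≤ γ * σ (ball x (2 ^ (k + 1) * r)) := by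
      refine h _ _ x (2 ^ (k + 1) * r) (by positivity) measurableSet_ball measurableSet_ball
        (ball_subset_ball (by rw [hE]; linarith)) subset_rfl
        (volume_ball_ne_zero x (by positivity)) (by simp) ?_
      rw [hE, volume_ball_mul x x hr' two_pos]
      gcongr
      simpa using le_self_pow₀ (a := (2 : ℝ≥0∞)) (by norm_num) hn
    calc σ (ball x r) ≤ γ ^ k * σ (ball x (2 ^ k * r)) := ih
      _ ≤ γ ^ k * (γ * σ (ball x (2 ^ (k + 1) * r))) := by gcongr
      _ = _ := by rw [pow_succ γ, mul_assoc]

lemma exists_rpow_lintegral_dyadic_le {b : Rn n → ℝ} (hb : IsBMO b) {σ : Measure (Rn n)}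
    (hσ : IsAInfty σ) {s : ℝ} (hs : 1 ≤ s) :
    ∃ D : ℝ≥0∞, D ≠ ∞ ∧ ∀ (x : Rn n) (r : ℝ), 0 < r → ∀ k : ℕ,
      (∫⁻ y in ball x (2 ^ k * r), ENNReal.ofReal |b y - avg b (ball x r)| ^ s ∂σ) ^ (1 / s) ≤
        D * (k + 1) * σ (ball x (2 ^ k * r)) ^ (1 / s) := by
  have hs0 : 0 < s := by linarith
  obtain ⟨D, hD, h⟩ := exists_lintegral_rpow_sub_avg_le hb hσ hs0
  refine ⟨D ^ (1 / s) + 2 ^ n * bmoNorm b, ENNReal.add_ne_top.2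
    ⟨ENNReal.rpow_ne_top_of_nonneg (by positivity) hD, ENNReal.mul_ne_top (by simp) hb.2⟩,
    fun x r hr k => ?_⟩
  set B := ball x (2 ^ k * r) with hB
  have hbm : AEMeasurable b σ := hb.1.aestronglyMeasurable.aemeasurable.mono_ac hσ.ac
  calc (∫⁻ y in B, ENNReal.ofReal |b y - avg b (ball x r)| ^ s ∂σ) ^ (1 / s)
      ≤ (∫⁻ y in B, ((fun y => ENNReal.ofReal |b y - avg b B| : Rn n → ℝ≥0∞) +
          (fun _ => ENNReal.ofReal |avg b B - avg b (ball x r)| : Rn n → ℝ≥0∞)) y ^ s ∂σ) ^ (1 / s) := by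
        gcongr with y
        rw [Pi.add_apply, ← ENNReal.ofReal_add (abs_nonneg _) (abs_nonneg _)]
        exact ENNReal.ofReal_le_ofReal (abs_sub_le _ _ _)
    _ ≤ (∫⁻ y in B, ENNReal.ofReal |b y - avg b B| ^ s ∂σ) ^ (1 / s) +
        (∫⁻ _ in B, ENNReal.ofReal |avg b B - avg b (ball x r)| ^ s ∂σ) ^ (1 / s) := by
        refine ENNReal.lintegral_Lp_add_le ?_ aemeasurable_const hs
        have := hbm.restrict (s := B)
        fun_prop
    _ ≤ (D * σ B) ^ (1 / s) + (k * (2 ^ n * bmoNorm b)) * σ B ^ (1 / s) := by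
        gcongr
        · exact h x _ (by positivity)
        · rw [setLIntegral_const, ENNReal.mul_rpow_of_nonneg _ _ (by positivity),
            ← ENNReal.rpow_mul, mul_one_div_cancel hs0.ne', ENNReal.rpow_one]
          gcongr
          exact ofReal_abs_avg_ball_sub_le hb.1 x hr k
    _ = (D ^ (1 / s) + 2 ^ n * bmoNorm b * k) * σ B ^ (1 / s) := by
        rw [ENNReal.mul_rpow_of_nonneg _ _ (by positivity)]; ring
    _ ≤ _ := by
        gcongr
        rw [add_mul]
        gcongr
        · exact le_mul_of_one_le_right' le_add_self
        · exact le_self_add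

/-- The measure with density `w ^ s`. -/
def powMeas (w : Rn n → ℝ) (s : ℝ) : Measure (Rn n) :=
  volume.withDensity fun y => ENNReal.ofReal (w y) ^ s

lemma powMeas_apply (w : Rn n → ℝ) (s : ℝ) {E : Set (Rn n)} (hE : MeasurableSet E) :
    powMeas w s E = ∫⁻ y in E, ENNReal.ofReal (w y) ^ s :=
  withDensity_apply _ hE

variable {w : Rn n → ℝ} {p q : ℝ}

lemma IsApq.ae_eq_zero_or (hw : IsWeight w) (hp : 1 < p) (hq : 0 < q) (h : IsApq p q w) :
    (∀ᵐ x, ENNReal.ofReal (w x) = 0) ∨ ∀ᵐ x, ENNReal.ofReal (w x) ≠ 0 := by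
  obtain ⟨C, hC⟩ := h
  have hwm : AEMeasurable (fun y => ENNReal.ofReal (w y)) volume :=
    hw.2.aestronglyMeasurable.aemeasurable.ennreal_ofReal
  have hp' : 0 < p / (p - 1) := div_pos (by linarith) (by linarith)
  have hp1 : 0 < 1 - 1 / p := by
    rw [sub_pos, div_lt_one (by linarith)]; exact hp
  have hball : ∀ r : ℝ, 0 < r →
      (∀ᵐ x ∂volume.restrict (ball (0 : Rn n) r), ENNReal.ofReal (w x) = 0) ∨
      ∀ᵐ x ∂volume.restrict (ball (0 : Rn n) r), ENNReal.ofReal (w x) ≠ 0 := by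
    intro r hr
    have hv0 : (volume (ball (0 : Rn n) r))⁻¹ ≠ 0 := by simp [measure_ball_lt_top.ne]
    by_cases hfin : ∫⁻ y in ball (0 : Rn n) r, ENNReal.ofReal (w y) ^ (-(p / (p - 1))) = ∞
    · left
      have h1 := hC 0 r hr
      rw [hfin, ENNReal.mul_top hv0, ENNReal.top_rpow_of_pos hp1] at h1
      have h2 : ((volume (ball (0 : Rn n) r))⁻¹ *
          ∫⁻ y in ball (0 : Rn n) r, ENNReal.ofReal (w y) ^ q) ^ (1 / q) = 0 := by
        by_contra hne
        rw [ENNReal.mul_top hne] at h1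
        exact absurd h1 (by simp)
      rw [ENNReal.rpow_eq_zero_iff_of_pos (by positivity), mul_eq_zero, or_iff_right hv0,
        lintegral_eq_zero_iff' (hwm.restrict.pow_const q)] at h2
      filter_upwards [h2] with x hx
      exact (ENNReal.rpow_eq_zero_iff_of_pos hq).1 hx
    · right
      filter_upwards [ae_lt_top' (hwm.restrict.pow_const _) hfin] with x hx h0
      rw [h0, ENNReal.zero_rpow_of_neg (by linarith)] at hx
      exact absurd hx (by simp)
  have hglob : ∀ P : Rn n → Prop,
      (∃ᶠ k : ℕ in Filter.atTop, ∀ᵐ x ∂volume.restrict (ball (0 : Rn n) (k + 1)), P x) →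
      ∀ᵐ x, P x := by
    intro P hP
    have hall : ∀ m : ℕ, ∀ᵐ x ∂volume.restrict (ball (0 : Rn n) m), P x := fun m => by
      obtain ⟨k, hPk, hk⟩ := (hP.and_eventually (Filter.eventually_ge_atTop m)).exists
      refine ae_restrict_of_ae_restrict_of_subset (ball_subset_ball ?_) hPk
      have : (m : ℝ) ≤ k := by exact_mod_cast hk
      linarith
    have := (ae_restrict_iUnion_iff (fun m : ℕ => ball (0 : Rn n) m) P).2 hall
    rwa [iUnion_ball_nat, Measure.restrict_univ] at this
  by_cases hfr : ∃ᶠ k : ℕ in Filter.atTop,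
      ∀ᵐ x ∂volume.restrict (ball (0 : Rn n) (k + 1)), ENNReal.ofReal (w x) = 0
  · exact Or.inl (hglob _ hfr)
  · refine Or.inr (hglob _ (Filter.Eventually.frequently ?_))
    filter_upwards [Filter.not_frequently.1 hfr] with k hk
    exact (hball (k + 1) (by positivity)).resolve_left hk

lemma IsApq.isAInfty (hw : IsWeight w) (hp : 1 < p) (hq : 0 < q) (h : IsApq p q w)
    (h0 : ∀ᵐ x, ENNReal.ofReal (w x) ≠ 0) :
    IsAInfty (powMeas w q) ∧ IsAInfty (powMeas w (-(p / (p - 1)))) ∧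
      ∀ (x : Rn n) (r : ℝ), 0 < r → powMeas w q (ball x r) ≠ 0 := by
  obtain ⟨C, hC⟩ := h
  have hwm : AEMeasurable (fun y => ENNReal.ofReal (w y)) volume :=
    hw.2.aestronglyMeasurable.aemeasurable.ennreal_ofReal
  set p' : ℝ := p / (p - 1) with hp'def
  have hp1 : 0 < p - 1 := by linarith
  have hp' : 0 < p' := div_pos (by linarith) hp1
  set σ := powMeas w (-p') with hσ
  set τ := powMeas w q with hτ
  set θ : ℝ := q / (p' + q) with hθ
  set η : ℝ := p' / (p' + q) with hη
  have hθ0 : 0 < θ := by positivity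
  have hη0 : 0 < η := by positivity
  have hsum : θ + η = 1 := by rw [hθ, hη]; field_simp; ring
  have h1 : ∀ F, MeasurableSet F → volume F ≤ σ F ^ θ * τ F ^ η := by
    intro F hF
    rw [hσ, hτ, powMeas_apply w _ hF, powMeas_apply w _ hF]
    refine le_trans (le_of_eq ?_) (ENNReal.lintegral_mul_norm_pow_le (hwm.restrict.pow_const _)
      (hwm.restrict.pow_const _) hθ0.le hη0.le hsum)
    rw [← setLIntegral_one]
    refine lintegral_congr_ae ?_
    filter_upwards [ae_restrict_of_ae h0] with x hx
    rw [← ENNReal.rpow_mul, ← ENNReal.rpow_mul, ← ENNReal.rpow_add _ _ hx ENNReal.ofReal_ne_top]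
    have : -p' * θ + q * η = 0 := by rw [hθ, hη]; field_simp; ring
    rw [this, ENNReal.rpow_zero]
  set e : ℝ := p' * q / (p' + q) with he
  have he0 : 0 < e := by positivity
  have h2 : ∀ (x : Rn n) (r : ℝ), 0 < r →
      σ (ball x r) ^ θ * τ (ball x r) ^ η ≤ (C : ℝ≥0∞) ^ e * volume (ball x r) := by
    intro x r hr
    set v := volume (ball x r) with hv
    have hv0 : v ≠ 0 := volume_ball_ne_zero x hr
    have hvt : v ≠ ∞ := measure_ball_lt_top.ne
    have h3 := ENNReal.rpow_le_rpow (hC x r hr) he0.le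
    rw [← powMeas_apply w q measurableSet_ball, ← powMeas_apply w _ measurableSet_ball,
      ENNReal.mul_rpow_of_nonneg _ _ he0.le, ← ENNReal.rpow_mul, ← ENNReal.rpow_mul] at h3
    have e1 : 1 / q * e = η := by rw [he, hη]; field_simp
    have e2 : (1 - 1 / p) * e = θ := by
      have : 1 - 1 / p = 1 / p' := by rw [hp'def]; field_simp
      rw [this, he, hθ]; field_simp
    rw [e1, e2, ENNReal.mul_rpow_of_nonneg _ _ hη0.le, ENNReal.mul_rpow_of_nonneg _ _ hθ0.le] at h3
    calc σ (ball x r) ^ θ * τ (ball x r) ^ η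
        = (v⁻¹ ^ θ * v⁻¹ ^ η) * v * (σ (ball x r) ^ θ * τ (ball x r) ^ η) := by
          rw [← ENNReal.rpow_add_of_nonneg _ _ hθ0.le hη0.le, hsum, ENNReal.rpow_one,
            ENNReal.inv_mul_cancel hv0 hvt, one_mul]
      _ = v⁻¹ ^ η * τ (ball x r) ^ η * (v⁻¹ ^ θ * σ (ball x r) ^ θ) * v := by ring
      _ ≤ _ := by gcongr
  have hCt : (C : ℝ≥0∞) ^ e ≠ ∞ := ENNReal.rpow_ne_top_of_nonneg he0.le ENNReal.coe_ne_top
  have hσ0 : ∀ (x : Rn n) (r : ℝ), 0 < r → σ (ball x r) ≠ 0 := fun x r hr hz => by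
    have := h1 _ (measurableSet_ball (x := x) (ε := r))
    rw [hz, ENNReal.zero_rpow_of_pos hθ0, zero_mul, nonpos_iff_eq_zero] at this
    exact volume_ball_ne_zero x hr this
  have hτ0 : ∀ (x : Rn n) (r : ℝ), 0 < r → τ (ball x r) ≠ 0 := fun x r hr hz => by
    have := h1 _ (measurableSet_ball (x := x) (ε := r))
    rw [hz, ENNReal.zero_rpow_of_pos hη0, mul_zero, nonpos_iff_eq_zero] at this
    exact volume_ball_ne_zero x hr this
  have hprod : ∀ (x : Rn n) (r : ℝ), 0 < r → σ (ball x r) ^ θ * τ (ball x r) ^ η ≠ ∞ :=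
    fun x r hr => ne_top_of_le_ne_top (ENNReal.mul_ne_top hCt measure_ball_lt_top.ne) (h2 x r hr)
  have hσt : ∀ (x : Rn n) (r : ℝ), σ (ball x r) ≠ ∞ := fun x r hz => by
    rcases le_or_gt r 0 with hr | hr
    · simp [ball_eq_empty.2 hr] at hz
    · refine hprod x r hr ?_
      rw [hz, ENNReal.top_rpow_of_pos hθ0, ENNReal.top_mul]
      simp [ENNReal.rpow_eq_zero_iff, hτ0 x r hr, hη0.le]
  have hτt : ∀ (x : Rn n) (r : ℝ), τ (ball x r) ≠ ∞ := fun x r hz => by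
    rcases le_or_gt r 0 with hr | hr
    · simp [ball_eq_empty.2 hr] at hz
    · refine hprod x r hr ?_
      rw [hz, ENNReal.top_rpow_of_pos hη0, ENNReal.mul_top]
      simp [ENNReal.rpow_eq_zero_iff, hσ0 x r hr, hθ0.le]
  refine ⟨IsAInfty.of_pair (τ := σ) hCt hη0 hθ0.le (fun F hF => ?_) (fun x r hr => ?_)
    (withDensity_absolutelyContinuous _ _) hτt,
    IsAInfty.of_pair (τ := τ) hCt hθ0 hη0.le h1 h2 (withDensity_absolutelyContinuous _ _) hσt, hτ0⟩
  · rw [mul_comm]; exact h1 F hF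
  · rw [mul_comm]; exact h2 x r hr

end Weights

section Tail

lemma lintegral_kernel_compl_ball_le {α CK : ℝ} (hαn : α < n) {K : Rn n → Rn n → ℝ}
    (hK : ∀ x y : Rn n, x ≠ y → |K x y| ≤ CK * ‖x - y‖ ^ (α - (n : ℝ))) (g f : Rn n → ℝ)
    (x₀ x : Rn n) {r : ℝ} (hr : 0 < r) (hx : x ∈ ball x₀ r) :
    ∫⁻ y in (ball x₀ (2 * r))ᶜ, ENNReal.ofReal (|g y| * |K x y| * |f y|) ≤
      ∑' j : ℕ, ENNReal.ofReal |CK| * ENNReal.ofReal (2 ^ j * r) ^ (α - (n : ℝ)) *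
        ∫⁻ y in ball x₀ (2 ^ (j + 2) * r), ENNReal.ofReal |g y| * ENNReal.ofReal |f y| := by
  have hcover : (ball x₀ (2 * r))ᶜ ⊆
      ⋃ j : ℕ, ball x₀ (2 ^ (j + 2) * r) \ ball x₀ (2 ^ (j + 1) * r) := by
    intro y hy
    rw [mem_compl_iff, mem_ball, not_lt] at hy
    have hex : ∃ j : ℕ, dist y x₀ < 2 ^ (j + 2) * r := by
      obtain ⟨j, hj⟩ := pow_unbounded_of_one_lt (dist y x₀ / r) (one_lt_two (α := ℝ))
      refine ⟨j, ?_⟩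
      rw [div_lt_iff₀ hr] at hj
      refine hj.trans_le ?_
      gcongr
      · norm_num
      · omega
    classical
    refine mem_iUnion.2 ⟨Nat.find hex, Nat.find_spec hex, ?_⟩
    rw [mem_ball, not_lt]
    rcases h : Nat.find hex with _ | m
    · simpa using hy
    · exact not_lt.1 (Nat.find_min hex (m := m) (by omega))
  refine (lintegral_mono_set hcover).trans ((lintegral_iUnion_le _ _).trans
    (ENNReal.tsum_le_tsum fun j => ?_))
  have hj : 0 < 2 ^ j * r := by positivity
  have hct : ENNReal.ofReal |CK| * ENNReal.ofReal (2 ^ j * r) ^ (α - (n : ℝ)) ≠ ∞ := by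
    rw [ENNReal.ofReal_rpow_of_pos hj]
    exact ENNReal.mul_ne_top ENNReal.ofReal_ne_top ENNReal.ofReal_ne_top
  rw [← lintegral_const_mul' _ _ hct]
  refine le_trans (setLIntegral_mono' (measurableSet_ball.diff measurableSet_ball) fun y hy => ?_)
    (lintegral_mono_set sdiff_subset)
  have hd : 2 ^ j * r ≤ ‖x - y‖ := by
    have h1 : 2 ^ (j + 1) * r ≤ dist y x₀ := not_lt.1 hy.2
    have h2 : dist x x₀ < r := hx
    have h3 := dist_triangle_left y x₀ x
    have h4 : r ≤ 2 ^ j * r := le_mul_of_one_le_left hr.le (one_le_pow₀ one_le_two)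
    rw [← dist_eq_norm]
    rw [pow_succ] at h1
    linarith
  have hxy : x ≠ y := fun h => by
    rw [h, sub_self, norm_zero] at hd
    linarith
  have hKb : |K x y| ≤ |CK| * (2 ^ j * r) ^ (α - (n : ℝ)) := by
    refine (hK x y hxy).trans (mul_le_mul (le_abs_self _) ?_ (by positivity) (abs_nonneg _))
    exact Real.rpow_le_rpow_of_nonpos hj hd (by linarith)
  rw [ENNReal.ofReal_rpow_of_pos hj, ← ENNReal.ofReal_mul (abs_nonneg _),
    ← ENNReal.ofReal_mul (abs_nonneg _), ← ENNReal.ofReal_mul (by positivity)]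
  refine ENNReal.ofReal_le_ofReal ?_
  calc |g y| * |K x y| * |f y| = |K x y| * (|g y| * |f y|) := by ring
    _ ≤ _ := by gcongr

variable {w : Rn n → ℝ} {p q : ℝ}

lemma wMeas_rpow_eq (hw : IsWeight w) (hq : 0 ≤ q) {E : Set (Rn n)} (hE : MeasurableSet E) :
    wMeas (fun z => w z ^ q) E = powMeas w q E := by
  rw [powMeas_apply w q hE, wMeas]
  exact lintegral_congr fun x => (ENNReal.ofReal_rpow_of_nonneg (hw.1 x) hq).symm

lemma lintegral_mul_le_morreyNorm {κ : ℝ} (hw : IsWeight w) (hp : 1 < p) (hq : 0 < q)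
    (h0 : ∀ᵐ x, ENNReal.ofReal (w x) ≠ 0) (hτ0 : ∀ (x : Rn n) (r : ℝ), 0 < r →
      powMeas w q (ball x r) ≠ 0) (hτ : IsAInfty (powMeas w q)) {g : Rn n → ℝ}
    (hg : AEMeasurable g volume) (f : Rn n → ℝ) (x : Rn n) {r : ℝ} (hr : 0 < r) :
    ∫⁻ y in ball x r, ENNReal.ofReal |g y| * ENNReal.ofReal |f y| ≤
      (∫⁻ y in ball x r, ENNReal.ofReal |g y| ^ (p / (p - 1)) ∂(powMeas w (-(p / (p - 1))))) ^
          (1 / (p / (p - 1))) *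
        (morreyNorm p κ (fun z => w z ^ p) (fun z => w z ^ q) f *
          powMeas w q (ball x r) ^ (κ / p)) := by
  have hp0 : 0 < p := by linarith
  have hwm : AEMeasurable (fun y => ENNReal.ofReal (w y)) volume :=
    hw.2.aestronglyMeasurable.aemeasurable.ennreal_ofReal
  have hgm : AEMeasurable (fun y => ENNReal.ofReal |g y|) volume := by fun_prop
  have hpp : (p / (p - 1)).HolderConjugate p := (Real.HolderConjugate.conjExponent hp).symm
  refine (lintegral_mul_le_weighted hpp hgm.restrict hwm.restrict (fun _ => ENNReal.ofReal_ne_top)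
    (ae_restrict_of_ae h0) (fun _ => ENNReal.ofReal_ne_top)).trans (mul_le_mul' ?_ ?_)
  · refine le_of_eq ?_
    congr 1
    rw [powMeas, restrict_withDensity measurableSet_ball,
      lintegral_withDensity_eq_lintegral_mul₀ (hwm.restrict.pow_const _)
        (hgm.restrict.pow_const _)]
    exact lintegral_congr fun y => mul_comm _ _
  · set τB := powMeas w q (ball x r) with hτB
    have hB0 : τB ≠ 0 := hτ0 x r hr
    have hBt : τB ≠ ∞ := hτ.ball_ne_top x r
    have hN : (wMeas (fun z => w z ^ q) (ball x r) ^ (-κ) *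
        ∫⁻ y in ball x r, ENNReal.ofReal |f y| ^ p * ENNReal.ofReal (w y ^ p)) ^ (1 / p) ≤
        morreyNorm p κ (fun z => w z ^ p) (fun z => w z ^ q) f :=
      le_iSup_of_le x (le_iSup_of_le r (le_iSup_of_le hr le_rfl))
    have hI : ∫⁻ y in ball x r, ENNReal.ofReal |f y| ^ p * ENNReal.ofReal (w y ^ p) =
        ∫⁻ y in ball x r, ENNReal.ofReal |f y| ^ p * ENNReal.ofReal (w y) ^ p :=
      lintegral_congr fun y => by rw [ENNReal.ofReal_rpow_of_nonneg (hw.1 y) hp0.le]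
    rw [wMeas_rpow_eq hw hq.le measurableSet_ball, hI,
      ENNReal.mul_rpow_of_nonneg _ _ (by positivity), ← ENNReal.rpow_mul] at hN
    set J := (∫⁻ y in ball x r, ENNReal.ofReal |f y| ^ p * ENNReal.ofReal (w y) ^ p) ^ (1 / p)
    calc J = τB ^ (-κ * (1 / p)) * J * τB ^ (κ / p) := by
          rw [mul_right_comm, ← ENNReal.rpow_add _ _ hB0 hBt]
          have : -κ * (1 / p) + κ / p = 0 := by ring
          rw [this, ENNReal.rpow_zero, one_mul]
      _ ≤ _ := by gcongr

lemma exists_powMeas_mul_le {α : ℝ} (hp : 1 < p) (hq : 0 < q) (hn : n ≠ 0)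
    (hpq : 1 / q = 1 / p - α / n) (h : IsApq p q w) (hτ0 : ∀ (x : Rn n) (r : ℝ), 0 < r →
      powMeas w q (ball x r) ≠ 0) (hτ : IsAInfty (powMeas w q)) :
    ∃ C : ℝ≥0∞, C ≠ ∞ ∧ ∀ (x : Rn n) (r : ℝ), 0 < r →
      ENNReal.ofReal r ^ (α - (n : ℝ)) *
        powMeas w (-(p / (p - 1))) (ball x r) ^ (1 / (p / (p - 1))) ≤
      C * powMeas w q (ball x r) ^ (-(1 / q)) := by
  obtain ⟨C, hC⟩ := h
  have hp0 : 0 < p := by linarith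
  have hp1 : 0 < p - 1 := by linarith
  have e1 : 1 / (p / (p - 1)) = 1 - 1 / p := by field_simp
  have ht : 0 < 1 / q := by positivity
  have hs : 0 < 1 - 1 / p := by rw [← e1]; positivity
  set δ : ℝ := 1 / q + (1 - 1 / p) with hδ
  have hδ0 : 0 < δ := by positivity
  refine ⟨C * volume (ball (0 : Rn n) 1) ^ δ, ENNReal.mul_ne_top ENNReal.coe_ne_top
    (ENNReal.rpow_ne_top_of_nonneg hδ0.le measure_ball_lt_top.ne), fun x r hr => ?_⟩
  have h1 := hC x r hr
  rw [← powMeas_apply w q measurableSet_ball, ← powMeas_apply w _ measurableSet_ball] at h1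
  rw [e1]
  set v := volume (ball x r) with hv
  set τB := powMeas w q (ball x r) with hτB
  set σB := powMeas w (-(p / (p - 1))) (ball x r) with hσB
  have hB0 : τB ≠ 0 := hτ0 x r hr
  have hBt : τB ≠ ∞ := hτ.ball_ne_top x r
  have hv0 : v ≠ 0 := volume_ball_ne_zero x hr
  have hvt : v ≠ ∞ := measure_ball_lt_top.ne
  have hr0 : ENNReal.ofReal r ≠ 0 := (ENNReal.ofReal_pos.2 hr).ne'
  have hn0 : (n : ℝ) ≠ 0 := by exact_mod_cast hn
  have hvδ : ENNReal.ofReal r ^ (α - (n : ℝ)) * v ^ δ = volume (ball (0 : Rn n) 1) ^ δ := by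
    rw [hv, volume_ball_eq x hr, ENNReal.mul_rpow_of_nonneg _ _ hδ0.le, ← mul_assoc,
      ← ENNReal.rpow_natCast, ← ENNReal.rpow_mul,
      ← ENNReal.rpow_add _ _ hr0 ENNReal.ofReal_ne_top]
    have : α - n + n * δ = 0 := by rw [hδ, hpq]; field_simp; ring
    rw [this, ENNReal.rpow_zero, one_mul]
  rw [ENNReal.mul_rpow_of_nonneg _ _ ht.le, ENNReal.mul_rpow_of_nonneg _ _ hs.le] at h1
  have hv1 : v ^ δ * (v⁻¹ ^ (1 / q) * v⁻¹ ^ (1 - 1 / p)) = 1 := by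
    rw [← ENNReal.rpow_add_of_nonneg _ _ ht.le hs.le, ← ENNReal.mul_rpow_of_nonneg _ _ hδ0.le,
      ENNReal.mul_inv_cancel hv0 hvt, ENNReal.one_rpow]
  have hτ1 : τB ^ (1 / q) * τB ^ (-(1 / q)) = 1 := by
    rw [← ENNReal.rpow_add _ _ hB0 hBt, add_neg_cancel, ENNReal.rpow_zero]
  calc ENNReal.ofReal r ^ (α - (n : ℝ)) * σB ^ (1 - 1 / p)
      = ENNReal.ofReal r ^ (α - (n : ℝ)) * (v ^ δ * (v⁻¹ ^ (1 / q) * v⁻¹ ^ (1 - 1 / p))) *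
          σB ^ (1 - 1 / p) * (τB ^ (1 / q) * τB ^ (-(1 / q))) := by
        rw [hv1, hτ1, mul_one, mul_one]
    _ = ENNReal.ofReal r ^ (α - (n : ℝ)) * v ^ δ *
          (v⁻¹ ^ (1 / q) * τB ^ (1 / q) * (v⁻¹ ^ (1 - 1 / p) * σB ^ (1 - 1 / p))) *
          τB ^ (-(1 / q)) := by ring
    _ ≤ ENNReal.ofReal r ^ (α - (n : ℝ)) * v ^ δ * C * τB ^ (-(1 / q)) := by gcongr
    _ = _ := by rw [hvδ, mul_comm (C : ℝ≥0∞)]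

lemma tsum_add_three_mul_pow_ne_top {g : ℝ≥0∞} (hg : g < 1) :
    ∑' j : ℕ, ((j : ℝ≥0∞) + 3) * g ^ j ≠ ∞ := by
  have hg1 : g.toReal < 1 := by
    have := (ENNReal.toReal_lt_toReal hg.ne_top ENNReal.one_ne_top).2 hg
    simpa using this
  have hs : Summable fun j : ℕ => ((j : ℝ) + 3) * g.toReal ^ j := by
    have h1 := summable_pow_mul_geometric_of_norm_lt_one 1 (r := g.toReal)
      (by rwa [Real.norm_of_nonneg ENNReal.toReal_nonneg])
    have h2 := (summable_geometric_of_lt_one ENNReal.toReal_nonneg hg1).mul_left 3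
    refine (h1.add h2).congr fun j => ?_
    ring
  convert hs.tsum_ofReal_ne_top using 3 with j
  rw [ENNReal.ofReal_mul (by positivity), ENNReal.ofReal_pow ENNReal.toReal_nonneg,
    ENNReal.ofReal_toReal hg.ne_top, ENNReal.ofReal_add (by positivity) (by norm_num)]
  simp

lemma ae_eq_avg_of_bmoNorm_eq_zero {b : Rn n → ℝ} (hb : IsBMO b) (h : bmoNorm b = 0)
    (x : Rn n) {r : ℝ} (hr : 0 < r) : ∀ᵐ y, b y = avg b (ball x r) := by
  have hk : ∀ k : ℕ, ∀ᵐ y ∂volume.restrict (ball x (2 ^ k * r)), b y = avg b (ball x r) := by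
    intro k
    have h1 := lintegral_sub_avg_ball_le b x (r := 2 ^ k * r) (by positivity)
    have h2 := ofReal_abs_avg_ball_sub_le hb.1 x hr k
    rw [h, zero_mul, nonpos_iff_eq_zero] at h1
    simp only [h, mul_zero, nonpos_iff_eq_zero, ENNReal.ofReal_eq_zero, abs_nonpos_iff,
      sub_eq_zero] at h2
    have hbm := hb.1.aestronglyMeasurable.aemeasurable.restrict (s := ball x (2 ^ k * r))
    rw [lintegral_eq_zero_iff' (by fun_prop)] at h1
    filter_upwards [h1] with y hy
    simp only [Pi.zero_apply, ENNReal.ofReal_eq_zero, abs_nonpos_iff, sub_eq_zero] at hy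
    rw [hy, h2]
  have h3 := (ae_restrict_iUnion_iff (fun k : ℕ => ball x (2 ^ k * r)) _).2 hk
  have h4 : ⋃ k : ℕ, ball x (2 ^ k * r) = univ := by
    refine eq_univ_of_forall fun y => mem_iUnion.2 ?_
    obtain ⟨j, hj⟩ := pow_unbounded_of_one_lt (dist y x / r) (one_lt_two (α := ℝ))
    exact ⟨j, (div_lt_iff₀ hr).1 hj⟩
  rwa [h4, Measure.restrict_univ] at h3

end Tail

/-- The weighted Morrey bound for the tail term, with a constant allowed to depend on `b`, when the
weight does not vanish. -/
lemma exists_morrey_tail_le {α p q κ CK : ℝ} {w : Rn n → ℝ} {K : Rn n → Rn n → ℝ} {b : Rn n → ℝ}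
    (hn : n ≠ 0) (hαn : α < n) (hp : 1 < p) (hq : 0 < q)
    (hpq : 1 / q = 1 / p - α / n) (hκ' : κ < p / q)
    (hw : IsWeight w) (hApq : IsApq p q w) (h0 : ∀ᵐ x, ENNReal.ofReal (w x) ≠ 0)
    (hK : ∀ x y : Rn n, x ≠ y → |K x y| ≤ CK * ‖x - y‖ ^ (α - (n : ℝ))) (hb : IsBMO b) :
    ∃ C : ℝ≥0∞, C ≠ ∞ ∧ ∀ (f : Rn n → ℝ) (x₀ : Rn n) (r : ℝ), 0 < r →
      (wMeas (fun z => w z ^ q) (ball x₀ r)) ^ (-(κ / p)) *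
        (∫⁻ x in ball x₀ r,
          (∫⁻ y in (ball x₀ (2 * r))ᶜ,
              ENNReal.ofReal (|b y - avg b (ball x₀ r)| * |K x y| * |f y|)) ^ q *
            ENNReal.ofReal (w x ^ q)) ^ (1 / q) ≤
        C * morreyNorm p κ (fun z => w z ^ p) (fun z => w z ^ q) f := by
  have hp0 : 0 < p := by linarith
  obtain ⟨hτ, hσ, hτ0⟩ := hApq.isAInfty hw hp hq h0
  have hp' : 1 ≤ p / (p - 1) := by rw [one_le_div (by linarith)]; linarith
  obtain ⟨D, hD, hosc⟩ := exists_rpow_lintegral_dyadic_le hb hσ hp'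
  obtain ⟨C₁, hC₁, hvol⟩ := exists_powMeas_mul_le hp hq hn hpq hApq hτ0 hτ
  obtain ⟨γ, hγ, hgeo⟩ := hτ.exists_ball_le_pow_mul hn
  set u : ℝ := 1 / q - κ / p with hu
  have hu0 : 0 < u := by
    rw [hu, sub_pos, div_lt_div_iff₀ hp0 hq]
    rw [lt_div_iff₀ hq] at hκ'
    linarith
  have hg : γ ^ u < 1 := by
    simpa using ENNReal.rpow_lt_rpow hγ hu0
  set c : ℝ≥0∞ := ENNReal.ofReal |CK| * ENNReal.ofReal 4 ^ ((n : ℝ) - α) * D * C₁ with hc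
  have hct : c ≠ ∞ := by
    refine ENNReal.mul_ne_top (ENNReal.mul_ne_top (ENNReal.mul_ne_top ENNReal.ofReal_ne_top ?_) hD)
      hC₁
    exact ENNReal.rpow_ne_top_of_nonneg (by linarith) ENNReal.ofReal_ne_top
  refine ⟨c * ∑' j : ℕ, ((j : ℝ≥0∞) + 3) * (γ ^ u) ^ j,
    ENNReal.mul_ne_top hct (tsum_add_three_mul_pow_ne_top hg), fun f x₀ r hr => ?_⟩
  set M := morreyNorm p κ (fun z => w z ^ p) (fun z => w z ^ q) f with hM
  set τ := powMeas w q with hτdef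
  set m := avg b (ball x₀ r) with hm
  set G : ℝ≥0∞ := ∑' j : ℕ, ENNReal.ofReal |CK| * ENNReal.ofReal (2 ^ j * r) ^ (α - (n : ℝ)) *
    ∫⁻ y in ball x₀ (2 ^ (j + 2) * r), ENNReal.ofReal |b y - m| * ENNReal.ofReal |f y| with hG
  have hB0 : τ (ball x₀ r) ≠ 0 := hτ0 x₀ r hr
  have hBt : τ (ball x₀ r) ≠ ∞ := hτ.ball_ne_top x₀ r
  have hinner : (∫⁻ x in ball x₀ r,
      (∫⁻ y in (ball x₀ (2 * r))ᶜ, ENNReal.ofReal (|b y - m| * |K x y| * |f y|)) ^ q *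
        ENNReal.ofReal (w x ^ q)) ^ (1 / q) ≤ G * τ (ball x₀ r) ^ (1 / q) := by
    calc _ ≤ (∫⁻ x in ball x₀ r, G ^ q * ENNReal.ofReal (w x) ^ q) ^ (1 / q) := by
          refine ENNReal.rpow_le_rpow (setLIntegral_mono' measurableSet_ball fun x hx => ?_)
            (by positivity)
          rw [ENNReal.ofReal_rpow_of_nonneg (hw.1 x) hq.le]
          gcongr
          exact lintegral_kernel_compl_ball_le hαn hK (fun y => b y - m) f x₀ x hr hx
      _ = G * τ (ball x₀ r) ^ (1 / q) := by
          have hwm : AEMeasurable (fun y => ENNReal.ofReal (w y)) volume :=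
            hw.2.aestronglyMeasurable.aemeasurable.ennreal_ofReal
          rw [lintegral_const_mul'' _ (hwm.restrict.pow_const q),
            ← powMeas_apply w q measurableSet_ball, ENNReal.mul_rpow_of_nonneg _ _ (by positivity),
            ← ENNReal.rpow_mul, mul_one_div_cancel hq.ne', ENNReal.rpow_one]
  have hterm : ∀ j : ℕ, ENNReal.ofReal |CK| * ENNReal.ofReal (2 ^ j * r) ^ (α - (n : ℝ)) *
      (∫⁻ y in ball x₀ (2 ^ (j + 2) * r), ENNReal.ofReal |b y - m| * ENNReal.ofReal |f y|) *
        τ (ball x₀ r) ^ u ≤ c * (((j : ℝ≥0∞) + 3) * (γ ^ u) ^ j) * M := by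
    intro j
    have hR : 0 < 2 ^ (j + 2) * r := by positivity
    set R := 2 ^ (j + 2) * r with hRdef
    have hR0 : τ (ball x₀ R) ≠ 0 := hτ0 x₀ R hR
    have hRt : τ (ball x₀ R) ≠ ∞ := hτ.ball_ne_top x₀ R
    have hI := (lintegral_mul_le_morreyNorm (κ := κ) hw hp hq h0 hτ0 hτ
      (hb.1.aestronglyMeasurable.aemeasurable.sub_const m) f x₀ hR).trans
        (mul_le_mul' (hosc x₀ r hr (j + 2)) le_rfl)
    have hscale : ENNReal.ofReal (2 ^ j * r) ^ (α - (n : ℝ)) =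
        ENNReal.ofReal 4 ^ ((n : ℝ) - α) * ENNReal.ofReal R ^ (α - (n : ℝ)) := by
      rw [ENNReal.ofReal_rpow_of_pos (by positivity), ENNReal.ofReal_rpow_of_pos (by norm_num),
        ENNReal.ofReal_rpow_of_pos hR, ← ENNReal.ofReal_mul (by positivity)]
      congr 1
      have : R = 4 * (2 ^ j * r) := by rw [hRdef]; ring
      rw [this, Real.mul_rpow (x := 4) (by norm_num) (by positivity), ← mul_assoc,
        ← Real.rpow_add (by norm_num)]
      simp
    have hdec : τ (ball x₀ R) ^ (-u) * τ (ball x₀ r) ^ u ≤ (γ ^ u) ^ j := by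
      have h1 : τ (ball x₀ r) ≤ γ ^ j * τ (ball x₀ R) := by
        refine (hgeo x₀ r hr (j + 2)).trans (mul_le_mul' ?_ le_rfl)
        exact pow_le_pow_right_of_le_one' hγ.le (by omega)
      calc _ ≤ τ (ball x₀ R) ^ (-u) * (γ ^ j * τ (ball x₀ R)) ^ u := by gcongr
        _ = (γ ^ j) ^ u * (τ (ball x₀ R) ^ (-u) * τ (ball x₀ R) ^ u) := by
          rw [ENNReal.mul_rpow_of_nonneg _ _ hu0.le]; ring
        _ = (γ ^ u) ^ j := by
          rw [← ENNReal.rpow_add _ _ hR0 hRt, neg_add_cancel, ENNReal.rpow_zero, mul_one,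
            ← ENNReal.rpow_natCast, ← ENNReal.rpow_natCast, ← ENNReal.rpow_mul,
            ← ENNReal.rpow_mul, mul_comm]
    have hexp : τ (ball x₀ R) ^ (-(1 / q)) * τ (ball x₀ R) ^ (κ / p) = τ (ball x₀ R) ^ (-u) := by
      rw [← ENNReal.rpow_add _ _ hR0 hRt]
      congr 1
      rw [hu]; ring
    have hcast : ((j + 2 : ℕ) : ℝ≥0∞) + 1 = j + 3 := by
      push_cast; rw [add_assoc]; norm_num
    rw [hcast] at hI
    rw [hscale]
    set S := powMeas w (-(p / (p - 1))) (ball x₀ R) ^ (1 / (p / (p - 1))) with hS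
    calc _ ≤ ENNReal.ofReal |CK| *
          (ENNReal.ofReal 4 ^ ((n : ℝ) - α) * ENNReal.ofReal R ^ (α - (n : ℝ))) *
          (D * (j + 3) * S * (M * τ (ball x₀ R) ^ (κ / p))) * τ (ball x₀ r) ^ u :=
          mul_le_mul' (mul_le_mul' le_rfl hI) le_rfl
      _ = ENNReal.ofReal |CK| * ENNReal.ofReal 4 ^ ((n : ℝ) - α) * D * (j + 3) *
          (ENNReal.ofReal R ^ (α - (n : ℝ)) * S) * τ (ball x₀ R) ^ (κ / p) *
          τ (ball x₀ r) ^ u * M := by ring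
      _ ≤ ENNReal.ofReal |CK| * ENNReal.ofReal 4 ^ ((n : ℝ) - α) * D * (j + 3) *
          (C₁ * τ (ball x₀ R) ^ (-(1 / q))) * τ (ball x₀ R) ^ (κ / p) *
          τ (ball x₀ r) ^ u * M := by
          have := hvol x₀ R hR
          gcongr
      _ = c * (j + 3) * (τ (ball x₀ R) ^ (-(1 / q)) * τ (ball x₀ R) ^ (κ / p) *
          τ (ball x₀ r) ^ u) * M := by rw [hc]; ring
      _ ≤ c * (j + 3) * (γ ^ u) ^ j * M := by
          rw [hexp]; gcongr
      _ = _ := by ring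
  rw [wMeas_rpow_eq hw hq.le measurableSet_ball]
  calc τ (ball x₀ r) ^ (-(κ / p)) * _ ≤
        τ (ball x₀ r) ^ (-(κ / p)) * (G * τ (ball x₀ r) ^ (1 / q)) := mul_le_mul' le_rfl hinner
    _ = G * τ (ball x₀ r) ^ u := by
        rw [mul_left_comm, ← ENNReal.rpow_add _ _ hB0 hBt, hu]
        congr 2
        ring
    _ ≤ _ := by
        rw [hG, ← ENNReal.tsum_mul_right, ← ENNReal.tsum_mul_left, ← ENNReal.tsum_mul_right]
        exact ENNReal.tsum_le_tsum hterm


/-- the estimate (3.11) for the term II: with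
`G(x) = ∫_{ℝⁿ∖2B} |b(y)-b_B| |K(x,y)| |f(y)| dy`, one has
`w^q(B)^{-κ/p} (∫_B G^q w^q)^{1/q} ≤ C ‖b‖_* ‖f‖_{L^{p,κ}(w^p,w^q)}`. -/
theorem stmt14 (n : ℕ) (α p q κ CK : ℝ) (w : Rn n → ℝ) (K : Rn n → Rn n → ℝ)
    (b : Rn n → ℝ)
    (hα : 0 < α) (hαn : α < n) (hp : 1 < p) (hpn : p < n / α)
    (hq : 1 / q = 1 / p - α / n) (hκ : 0 < κ) (hκ' : κ < p / q)
    (hw : IsWeight w) (hApq : IsApq p q w)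
    (hKm : Measurable (Function.uncurry K))
    (hK : ∀ x y : Rn n, x ≠ y → |K x y| ≤ CK * ‖x - y‖ ^ (α - (n : ℝ)))
    (hb : IsBMO b) :
    ∃ C : ℝ≥0, ∀ (f : Rn n → ℝ) (x₀ : Rn n) (r : ℝ), 0 < r →
      (wMeas (fun z => w z ^ q) (ball x₀ r)) ^ (-(κ / p)) *
        (∫⁻ x in ball x₀ r,
          (∫⁻ y in (ball x₀ (2 * r))ᶜ,
              ENNReal.ofReal (|b y - avg b (ball x₀ r)| * |K x y| * |f y|)) ^ q *
            ENNReal.ofReal (w x ^ q)) ^ (1 / q) ≤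
        (C : ℝ≥0∞) * bmoNorm b *
          morreyNorm p κ (fun z => w z ^ p) (fun z => w z ^ q) f := by
  have hn0 : (0 : ℝ) < n := hα.trans hαn
  have hn : n ≠ 0 := by rintro rfl; simp at hn0
  have hp0 : 0 < p := by linarith
  have hq0 : 0 < q := by
    have h1 : 0 < 1 / q := by
      rw [hq, sub_pos, div_lt_div_iff₀ hn0 hp0]
      rw [lt_div_iff₀ hα] at hpn
      linarith
    exact one_div_pos.1 h1
  rcases hApq.ae_eq_zero_or hw hp hq0 with h0 | h0
  · refine ⟨0, fun f x₀ r hr => ?_⟩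
    rw [lintegral_eq_zero_of_ae_eq_zero, ENNReal.zero_rpow_of_pos (by positivity), mul_zero]
    · exact zero_le
    · filter_upwards [ae_restrict_of_ae h0] with x hx
      rw [← ENNReal.ofReal_rpow_of_nonneg (hw.1 x) hq0.le, hx, ENNReal.zero_rpow_of_pos hq0,
        mul_zero, Pi.zero_apply]
  by_cases hb0 : bmoNorm b = 0
  · refine ⟨0, fun f x₀ r hr => ?_⟩
    have hin : ∀ x, ∫⁻ y in (ball x₀ (2 * r))ᶜ,
        ENNReal.ofReal (|b y - avg b (ball x₀ r)| * |K x y| * |f y|) = 0 := fun x => by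
      refine lintegral_eq_zero_of_ae_eq_zero ?_
      filter_upwards [ae_restrict_of_ae (ae_eq_avg_of_bmoNorm_eq_zero hb hb0 x₀ hr)] with y hy
      simp [hy]
    simp only [hin, ENNReal.zero_rpow_of_pos hq0, zero_mul, lintegral_zero]
    rw [ENNReal.zero_rpow_of_pos (by positivity), mul_zero]
    exact zero_le
  · obtain ⟨C, hC, h⟩ := exists_morrey_tail_le hn hαn hp hq0 hq hκ' hw hApq h0 hK hb
    have hCb : C / bmoNorm b ≠ ∞ := ENNReal.div_ne_top hC hb0
    refine ⟨(C / bmoNorm b).toNNReal, fun f x₀ r hr => ?_⟩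
    rw [ENNReal.coe_toNNReal hCb, ENNReal.div_mul_cancel hb0 hb.2]
    exact h f x₀ r hr
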